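/- arXiv:1308.0519 — 2 statements merged into one kernel-verified Lean document; each statement's English description precedes it below -/
import Mathlib

section
/- Let α > 0 be fixed and let 0 < c₁ ≤ c₂ be constants. Then there exists a constant C > 0, depending only on α, c₁, c₂, such that for every λ ∈ [c₁, c₂] and every C² function u on the closed unit ball of ℝ² satisfying u > 0 in the open unit ball B₁, u = 0 on the boundary |x| = 1, and −Δu(x) = ((2+α)/2)²·λ·|x|^α·e^{u(x)} for all x ∈ B₁, one has sup_{x ∈ B₁} u(x) ≤ C. -/
open Set MeasureTheory

noncomputable section

/-- The Euclidean Laplacian on `ℝ²`: the sum of the two second partial derivatives. -/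
def planeLaplacian (u : EuclideanSpace ℝ (Fin 2) → ℝ) (x : EuclideanSpace ℝ (Fin 2)) : ℝ :=
  ∑ i : Fin 2,
    deriv (deriv (fun t : ℝ => u (x + t • EuclideanSpace.single i (1 : ℝ)))) 0


/-- A priori bound for the boundary flux. -/
lemma flux_bound (A B : ℝ) (hB : 0 < B) (hAB : A ≤ B) (p q : ℝ → ℝ)
    (hp : ∀ x, HasDerivAt p (q x) x) (hq : Continuous q)
    (h1 : ∫ x in (0:ℝ)..(2*Real.pi), (A - p x ^ 2) = 0)
    (h2 : ∫ x in (0:ℝ)..(2*Real.pi), ((A - p x ^ 2)^2 - 16 * q x ^ 2) = 0) :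
    (∫ x in (0:ℝ)..(2*Real.pi), q x ^ 2) ≤ Real.pi ^ 3 * B ^ 3 / 8 ∧
    ∀ x ∈ Icc (0:ℝ) (2*Real.pi), p x ^ 2 ≤ B + Real.pi ^ 2 * B ^ 2 := by
  have hpi := Real.pi_pos
  have hpc : Continuous p := continuous_iff_continuousAt.2 fun x => (hp x).continuousAt
  set E := ∫ x in (0:ℝ)..(2*Real.pi), q x ^ 2 with hE
  have h2pi : (0:ℝ) ≤ 2*Real.pi := by positivity
  -- integral of p^2
  have ip : ∫ x in (0:ℝ)..(2*Real.pi), p x ^ 2 = 2*Real.pi*A := by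
    rw [intervalIntegral.integral_sub (by simp) ((by fun_prop : Continuous fun x => p x ^ 2).intervalIntegrable _ _)] at h1
    simp at h1; linarith
  have hA : 0 ≤ A := by
    have : 0 ≤ ∫ x in (0:ℝ)..(2*Real.pi), p x ^ 2 :=
      intervalIntegral.integral_nonneg h2pi (fun x _ => sq_nonneg _)
    rw [ip] at this
    by_contra h
    push Not at h
    nlinarith
  have ip4 : ∫ x in (0:ℝ)..(2*Real.pi), (A - p x ^ 2)^2 = 16 * E := by
    rw [intervalIntegral.integral_sub ((by fun_prop : Continuous fun x => (A - p x ^ 2)^2).intervalIntegrable _ _)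
      ((by fun_prop : Continuous fun x => 16 * q x ^ 2).intervalIntegrable _ _),
      intervalIntegral.integral_const_mul] at h2
    linarith
  set S := ∫ x in (0:ℝ)..(2*Real.pi), |2 * p x * q x| with hS
  -- pointwise
  have hpq : Continuous fun x => 2 * p x * q x := by fun_prop
  have hosc : ∀ x ∈ Icc (0:ℝ) (2*Real.pi), ∀ y ∈ Icc (0:ℝ) (2*Real.pi), p x ^ 2 - p y ^ 2 ≤ S := by
    intro x hx y hy
    have hd : ∀ t ∈ uIcc y x, HasDerivAt (fun x => p x ^ 2) (2 * p t * q t) t := by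
      intro t _
      have := (hp t).fun_pow 2
      simpa using this
    have := intervalIntegral.integral_eq_sub_of_hasDerivAt hd (hpq.intervalIntegrable _ _)
    rw [← this]
    refine (le_abs_self _).trans ?_
    refine (intervalIntegral.norm_integral_le_abs_integral_norm (f := fun t => 2 * p t * q t)).trans ?_
    simp only [Real.norm_eq_abs]
    refine (le_abs_self _).trans ?_
    rw [abs_abs]
    have h0 := intervalIntegral.abs_integral_mono_interval (f := fun t => |2 * p t * q t|) (μ := volume)
      (a := y) (b := x) (c := 0) (d := 2*Real.pi) ?_ ?_ (hpq.abs.intervalIntegrable _ _)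
    · refine h0.trans (le_of_eq (abs_of_nonneg ?_))
      exact intervalIntegral.integral_nonneg h2pi (fun x _ => abs_nonneg _)
    · rw [uIoc_of_le h2pi]
      rw [uIoc]
      exact Ioc_subset_Ioc (le_min hy.1 hx.1) (max_le hy.2 hx.2)
    · exact Filter.Eventually.of_forall fun t => abs_nonneg _
  have hsup : ∀ x ∈ Icc (0:ℝ) (2*Real.pi), p x ^ 2 ≤ A + S := by
    intro x hx
    have : ∫ y in (0:ℝ)..(2*Real.pi), (p x ^ 2 - S) ≤ ∫ y in (0:ℝ)..(2*Real.pi), p y ^ 2 := by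
      refine intervalIntegral.integral_mono_on h2pi (by simp) ((by fun_prop : Continuous fun x => p x ^ 2).intervalIntegrable _ _) ?_
      intro y hy
      have := hosc x hx y hy
      linarith
    rw [ip] at this
    simp only [intervalIntegral.integral_const, smul_eq_mul, sub_zero] at this
    have := le_of_mul_le_mul_left this (by positivity : 0 < 2*Real.pi)
    linarith
  have hES : 16 * E ≤ 2*Real.pi*A*S := by
    rw [← ip4]
    have : ∫ x in (0:ℝ)..(2*Real.pi), (A - p x ^ 2)^2 ≤ ∫ x in (0:ℝ)..(2*Real.pi), (A^2 + (S - A) * p x ^ 2) := by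
      refine intervalIntegral.integral_mono_on h2pi ((by fun_prop : Continuous fun x => (A - p x ^ 2)^2).intervalIntegrable _ _) ((by fun_prop : Continuous fun x => A^2 + (S-A) * p x ^ 2).intervalIntegrable _ _) ?_
      intro y hy
      have := hsup y hy
      nlinarith [sq_nonneg (p y)]
    refine this.trans (le_of_eq ?_)
    rw [intervalIntegral.integral_add (by simp) ((by fun_prop : Continuous fun x => (S-A) * p x ^ 2).intervalIntegrable _ _),
      intervalIntegral.integral_const_mul, ip]
    simp; ring
  set ε := Real.pi * B / 4 with hε
  have hε0 : 0 < ε := by positivity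
  have hSE : S ≤ ε * (2*Real.pi*A) + E / ε := by
    rw [← ip, hE, div_eq_inv_mul, ← intervalIntegral.integral_const_mul, ← intervalIntegral.integral_const_mul,
      ← intervalIntegral.integral_add ((by fun_prop : Continuous fun x => ε * p x ^ 2).intervalIntegrable _ _) ((by fun_prop : Continuous fun x => ε⁻¹ * q x ^ 2).intervalIntegrable _ _)]
    refine intervalIntegral.integral_mono_on h2pi (hpq.abs.intervalIntegrable _ _) ((by fun_prop : Continuous fun x => ε * p x ^ 2 + ε⁻¹ * q x ^ 2).intervalIntegrable _ _) ?_
    intro y _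
    have e1 : ε * ε⁻¹ = 1 := mul_inv_cancel₀ hε0.ne'
    have e2 : 0 < ε⁻¹ := by positivity
    rw [abs_le]
    have k1 : 0 ≤ ε⁻¹ * (ε * p y - q y)^2 := by positivity
    have k2 : 0 ≤ ε⁻¹ * (ε * p y + q y)^2 := by positivity
    have k3 : ε⁻¹ * (ε * p y - q y)^2 = ε * p y ^ 2 * (ε * ε⁻¹) - 2 * p y * q y * (ε * ε⁻¹) + ε⁻¹ * q y ^ 2 := by ring
    have k4 : ε⁻¹ * (ε * p y + q y)^2 = ε * p y ^ 2 * (ε * ε⁻¹) + 2 * p y * q y * (ε * ε⁻¹) + ε⁻¹ * q y ^ 2 := by ring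
    rw [e1] at k3 k4
    constructor <;> linarith
  have hS0 : 0 ≤ S := intervalIntegral.integral_nonneg h2pi (fun x _ => abs_nonneg _)
  have hSE' : S ≤ ε * (2*Real.pi*B) + E / ε := by
    refine hSE.trans ?_
    gcongr
  have hES' : 16 * E ≤ 2*Real.pi*B*(ε * (2*Real.pi*B) + E / ε) := by
    refine hES.trans ?_
    gcongr
  have hEB : 2*Real.pi*B*(ε * (2*Real.pi*B) + E / ε) = Real.pi^3*B^3 + 8 * E := by
    rw [hε]; field_simp; ring
  have hEf : E ≤ Real.pi ^ 3 * B ^ 3 / 8 := by linarith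
  refine ⟨hEf, fun x hx => (hsup x hx).trans ?_⟩
  have : E / ε ≤ Real.pi^2*B^2/2 := by
    rw [div_le_iff₀ hε0, hε]; refine hEf.trans (le_of_eq ?_); ring
  have h3 : ε * (2*Real.pi*B) = Real.pi^2*B^2/2 := by rw [hε]; ring
  linarith

set_option maxHeartbeats 2000000 in
/-- The final ODE comparison argument on a ray. -/
lemma ray_bound (α B S1 c0 : ℝ) (hα : 0 < α) (hB : 0 < B) (hS1 : 0 < S1) (hc0 : 0 < c0) :
    ∃ c : ℝ, 0 < c ∧ ∀ f s f' s' : ℝ → ℝ,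
      (∀ r ∈ Ioo (0:ℝ) 1, HasDerivAt f (f' r) r) → (∀ r ∈ Ioo (0:ℝ) 1, HasDerivAt s (s' r) r) →
      ContinuousOn s (Ioc 0 1) →
      (∀ r ∈ Ioo (0:ℝ) 1, 0 < f r) → (∀ r ∈ Ioo (0:ℝ) 1, f r ≤ 1) → (∀ r ∈ Ioo (0:ℝ) 1, 0 < s r) →
      (∀ r ∈ Ioo (0:ℝ) 1, |f' r| ≤ s r) →
      (∀ r ∈ Ioo (0:ℝ) 1, α / 2 * s r - B / 2 * (Real.sqrt (1 - r))⁻¹ * f r ≤ r * s' r) →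
      s 1 ≤ S1 → (∀ r ∈ Ioo (0:ℝ) 1, c0 * r ^ (α/2) ≤ s r * f r) →
      ∀ r ∈ Ioo (0:ℝ) 1, c ≤ f r := by
  set κ := 4 * B / α with hκ
  have hκ0 : 0 < κ := by positivity
  set ρ0 := min (1/2 : ℝ) (α / (4 * κ)) with hρ0
  have hρ0p : 0 < ρ0 := by positivity
  have hρ0h : ρ0 ≤ 1/2 := min_le_left _ _
  have hρ0k : κ * ρ0 ≤ α / 4 := by
    have : ρ0 ≤ α / (4 * κ) := min_le_right _ _
    rw [le_div_iff₀ (by positivity)] at this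
    linarith
  set S3 := S1 + B / ρ0 with hS3
  have hS3p : 0 < S3 := by positivity
  set C1 := S3 * ρ0 ^ (-(α/4)) with hC1
  have hC1p : 0 < C1 := by positivity
  set ε := min 1 (c0 / (κ + C1)) with hε
  have hε0 : 0 < ε := by positivity
  have hε1 : ε ≤ 1 := min_le_left _ _
  have hε2 : (κ + C1) * ε ≤ c0 := by
    have : ε ≤ c0 / (κ + C1) := min_le_right _ _
    rw [le_div_iff₀ (by positivity)] at this
    linarith
  set C2 := κ + C1 / ε with hC2
  have hC2p : 0 < C2 := by positivity
  set m := c0 * ρ0 ^ (α/2) / S3 with hm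
  have hmp : 0 < m := by positivity
  refine ⟨m * Real.exp (-C2), by positivity, ?_⟩
  intro f s f' s' hf hs hsc f0 f1 s0 hfs hode hs1 hsf
  have hρ01 : ρ0 ∈ Ioo (0:ℝ) 1 := ⟨hρ0p, by linarith⟩
  -- step a
  have ha : ∀ r ∈ Ico ρ0 1, s r ≤ S3 := by
    intro r hr
    have hmono : MonotoneOn (fun r => s r - B / ρ0 * Real.sqrt (1 - r)) (Icc ρ0 1) := by
      refine monotoneOn_of_hasDerivWithinAt_nonneg (f' := fun r => s' r - B / ρ0 * (-1 / (2 * Real.sqrt (1 - r)))) (convex_Icc _ _) ?_ ?_ ?_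
      · refine ContinuousOn.sub (hsc.mono fun x hx => ⟨hρ0p.trans_le hx.1, hx.2⟩) (by fun_prop)
      · intro x hx
        rw [interior_Icc] at hx
        have hx' : x ∈ Ioo (0:ℝ) 1 := ⟨hρ0p.trans hx.1, hx.2⟩
        have h1 : HasDerivAt (fun r : ℝ => 1 - r) (-1) x := by simpa using (hasDerivAt_id x).const_sub 1
        have h2 := h1.sqrt (sub_pos.2 hx.2).ne'
        exact ((hs x hx').sub (h2.const_mul (B/ρ0))).hasDerivWithinAt
      · intro x hx
        rw [interior_Icc] at hx
        have hx' : x ∈ Ioo (0:ℝ) 1 := ⟨hρ0p.trans hx.1, hx.2⟩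
        have h := hode x hx'
        have hq : 0 < Real.sqrt (1 - x) := Real.sqrt_pos.2 (by linarith [hx.2])
        set w := (Real.sqrt (1 - x))⁻¹ with hw
        have hw0 : 0 < w := by positivity
        have e : B / ρ0 * (-1 / (2 * Real.sqrt (1 - x))) = - (B / ρ0 / 2 * w) := by
          rw [hw]; field_simp
        rw [e]
        have : - (B/2 * w) ≤ x * s' x := by
          have := mul_pos hα (s0 x hx')
          have h4 : B / 2 * w * f x ≤ B/2 * w * 1 := by gcongr; exact f1 x hx'
          linarith
        by_contra hneg
        push Not at hneg
        have h5 : s' x < - (B / ρ0 / 2 * w) := by linarith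
        have h6 : x * s' x < x * (- (B / ρ0 / 2 * w)) := by
          exact mul_lt_mul_of_pos_left h5 hx'.1
        have h7 : ρ0 * (B / ρ0 / 2 * w) ≤ x * (B / ρ0 / 2 * w) := by
          have := hx.1.le
          gcongr
        have h8 : ρ0 * (B / ρ0 / 2 * w) = B/2*w := by field_simp
        nlinarith
    have := hmono ⟨hr.1, hr.2.le⟩ ⟨hρ01.2.le, le_rfl⟩ hr.2.le
    simp only [sub_self, Real.sqrt_zero, mul_zero, sub_zero] at this
    have h9 : Real.sqrt (1 - r) ≤ 1 := by
      rw [Real.sqrt_le_iff]; constructor <;> linarith [hr.1]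
    have h10 : B / ρ0 * Real.sqrt (1 - r) ≤ B / ρ0 * 1 := by gcongr
    rw [hS3]; linarith
  have hfa : ∀ r ∈ Ico ρ0 1, m ≤ f r := by
    intro r hr
    have hr' : r ∈ Ioo (0:ℝ) 1 := ⟨hρ0p.trans_le hr.1, hr.2⟩
    rw [hm, div_le_iff₀ hS3p]
    have h1 := hsf r hr'
    have h2 : ρ0 ^ (α/2) ≤ r ^ (α/2) := Real.rpow_le_rpow hρ0p.le hr.1 (by positivity)
    have h3 : s r * f r ≤ S3 * f r := mul_le_mul_of_nonneg_right (ha r hr) (f0 r hr').le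
    nlinarith
  -- step c
  have hc : ∀ r ∈ Ioc 0 ρ0, s r ≤ κ * f r + C1 * r ^ (α/4) := by
    intro r hr
    have hmono : MonotoneOn (fun r => (s r - κ * f r) * r ^ (-(α/4))) (Icc r ρ0) := by
      have hsub : ∀ x ∈ Icc r ρ0, x ∈ Ioo (0:ℝ) 1 := fun x hx => ⟨hr.1.trans_le hx.1, by linarith [hx.2]⟩
      have hd : ∀ x ∈ Icc r ρ0, HasDerivAt (fun r => (s r - κ * f r) * r ^ (-(α/4)))
          ((s' x - κ * f' x) * x ^ (-(α/4)) + (s x - κ * f x) * (-(α/4) * x ^ (-(α/4) - 1))) x := by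
        intro x hx
        have hx' := hsub x hx
        exact ((hs x hx').sub ((hf x hx').const_mul κ)).mul (Real.hasDerivAt_rpow_const (Or.inl hx'.1.ne'))
      refine monotoneOn_of_hasDerivWithinAt_nonneg (convex_Icc _ _) (fun x hx => (hd x hx).continuousAt.continuousWithinAt) (fun x hx => (hd x (interior_subset hx)).hasDerivWithinAt) ?_
      intro x hx
      have hx1 := interior_subset hx
      have hx' := hsub x hx1
      have hx0 := hx'.1
      rw [Real.rpow_sub_one hx0.ne']
      have hpw : 0 < x ^ (-(α/4)) := by positivity
      have key : 0 ≤ x * (s' x - κ * f' x) - (α/4) * (s x - κ * f x) := by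
        have h := hode x hx'
        have hq : (Real.sqrt (1 - x))⁻¹ ≤ 2 := by
          rw [inv_le_comm₀ (Real.sqrt_pos.2 (by linarith [hx'.2])) (by norm_num)]
          rw [Real.le_sqrt (by norm_num) (by linarith [hx'.2])]
          have := hx1.2
          norm_num; linarith
        have h1 : B / 2 * (Real.sqrt (1 - x))⁻¹ * f x ≤ B / 2 * 2 * f x := by
          have := (f0 x hx').le
          gcongr
        have h2 : κ * (x * f' x) ≤ (α/4) * s x := by
          have hs0 := (s0 x hx').le
          have a1 : κ * (x * f' x) ≤ κ * (ρ0 * s x) := by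
            have a2 := le_abs_self (f' x)
            have a3 := hfs x hx'
            have a4 : x * f' x ≤ x * s x := mul_le_mul_of_nonneg_left (a2.trans a3) hx0.le
            have a5 : x * s x ≤ ρ0 * s x := mul_le_mul_of_nonneg_right hx1.2 hs0
            exact mul_le_mul_of_nonneg_left (a4.trans a5) hκ0.le
          have a6 : κ * ρ0 * s x ≤ α/4 * s x := mul_le_mul_of_nonneg_right hρ0k hs0
          linarith
        have h3 : α / 4 * κ = B := by rw [hκ]; field_simp
        have h4 : α / 4 * (κ * f x) = B * f x := by rw [← h3]; ring
        nlinarith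
      have e : (s' x - κ * f' x) * x ^ (-(α/4)) + (s x - κ * f x) * (-(α/4) * (x ^ (-(α/4)) / x))
        = (x ^ (-(α/4)) / x) * (x * (s' x - κ * f' x) - (α/4) * (s x - κ * f x)) := by
        field_simp; ring
      rw [e]
      positivity
    have h := hmono (left_mem_Icc.2 hr.2) (right_mem_Icc.2 hr.2) hr.2
    simp only at h
    have h2 : (s ρ0 - κ * f ρ0) * ρ0 ^ (-(α/4)) ≤ C1 := by
      rw [hC1]
      have := ha ρ0 ⟨le_rfl, hρ01.2⟩
      have := mul_pos hκ0 (f0 ρ0 hρ01)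
      gcongr; linarith
    have h3 : (s r - κ * f r) * r ^ (-(α/4)) ≤ C1 := h.trans h2
    rw [Real.rpow_neg hr.1.le, ← div_eq_mul_inv, div_le_iff₀ (Real.rpow_pos_of_pos hr.1 _)] at h3
    linarith
  have hd : ∀ r ∈ Ioc 0 ρ0, ε * r ^ (α/4) ≤ f r := by
    intro r hr
    have hr' : r ∈ Ioo (0:ℝ) 1 := ⟨hr.1, by linarith [hr.2]⟩
    by_contra hlt
    push Not at hlt
    have h1 := hsf r hr'
    have h2 := hc r hr
    have hP : 0 < r ^ (α/4) := Real.rpow_pos_of_pos hr.1 _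
    have hPP : r ^ (α/2) = r ^ (α/4) * r ^ (α/4) := by
      rw [← Real.rpow_add hr.1]; congr 1; ring
    rw [hPP] at h1
    set P := r ^ (α/4)
    have hf0 := f0 r hr'
    have h3 : s r < (κ + C1) * P := by
      have : κ * f r < κ * (ε * P) := by gcongr
      have : κ * (ε * P) ≤ κ * (1 * P) := by gcongr
      linarith
    have h4 : s r * f r < (κ + C1) * P * (ε * P) := by
      have := s0 r hr'
      gcongr
    have h5 : (κ + C1) * P * (ε * P) = (κ + C1) * ε * (P * P) := by ring
    have h6 : (κ + C1) * ε * (P * P) ≤ c0 * (P * P) := by gcongr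
    linarith
  have he : ∀ r ∈ Ioc 0 ρ0, s r ≤ C2 * f r := by
    intro r hr
    have h1 := hc r hr
    have h2 := hd r hr
    have : C1 * r ^ (α/4) ≤ C1 / ε * f r := by
      rw [div_mul_eq_mul_div, le_div_iff₀ hε0]
      nlinarith
    rw [hC2]; linarith
  intro r hr
  rcases le_or_gt ρ0 r with h | h
  · refine le_trans ?_ (hfa r ⟨h, hr.2⟩)
    have : Real.exp (-C2) ≤ 1 := Real.exp_le_one_iff.2 (by linarith)
    nlinarith
  · have hsub : ∀ x ∈ Icc r ρ0, x ∈ Ioo (0:ℝ) 1 := fun x hx => ⟨hr.1.trans_le hx.1, by linarith [hx.2]⟩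
    have hanti : AntitoneOn (fun x => f x * Real.exp (-C2 * x)) (Icc r ρ0) := by
      have hd' : ∀ x ∈ Icc r ρ0, HasDerivAt (fun x => f x * Real.exp (-C2 * x))
          (f' x * Real.exp (-C2 * x) + f x * (Real.exp (-C2 * x) * -C2)) x := by
        intro x hx
        have h1 : HasDerivAt (fun x : ℝ => -C2 * x) (-C2) x := by simpa using (hasDerivAt_id x).const_mul (-C2)
        exact (hf x (hsub x hx)).mul h1.exp
      refine antitoneOn_of_hasDerivWithinAt_nonpos (convex_Icc _ _) (fun x hx => (hd' x hx).continuousAt.continuousWithinAt) (fun x hx => (hd' x (interior_subset hx)).hasDerivWithinAt) ?_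
      intro x hx
      have hx1 := interior_subset hx
      have h1 := he x ⟨(hsub x hx1).1, hx1.2⟩
      have h2 := (le_abs_self _).trans (hfs x (hsub x hx1))
      have h3 := Real.exp_pos (-C2 * x)
      have : f' x * Real.exp (-C2 * x) + f x * (Real.exp (-C2 * x) * -C2) = (f' x - C2 * f x) * Real.exp (-C2*x) := by ring
      rw [this]
      exact mul_nonpos_of_nonpos_of_nonneg (by linarith) h3.le
    have h1 := hanti (left_mem_Icc.2 h.le) (right_mem_Icc.2 h.le) h.le
    simp only at h1
    have h2 := hfa ρ0 ⟨le_rfl, hρ01.2⟩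
    have h3 : Real.exp (-C2) ≤ Real.exp (-C2 * ρ0) := Real.exp_le_exp.2 (by nlinarith [hρ01.2])
    have h4 : f r * Real.exp (-C2 * r) ≤ f r * 1 := by
      have := (f0 r hr).le
      gcongr
      exact Real.exp_le_one_iff.2 (by nlinarith [hr.1])
    calc m * Real.exp (-C2) ≤ f ρ0 * Real.exp (-C2 * ρ0) :=
        mul_le_mul h2 h3 (Real.exp_pos _).le (f0 ρ0 hρ01).le
      _ ≤ _ := h1
      _ ≤ _ := by linarith

open Complex (I reCLM imCLM ofRealCLM)
open Metric (closedBall ball)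

/-- The real differential with partial derivatives `a`, `b`. -/
def dR (a b : ℝ) : ℂ →L[ℝ] ℝ := a • reCLM + b • imCLM

lemma dR_apply (a b : ℝ) (v : ℂ) : dR a b v = a * v.re + b * v.im := by simp [dR]

/-- The complex-valued real differential with partial derivatives `a`, `b`. -/
def dC (a b : ℂ) : ℂ →L[ℝ] ℂ := a • (ofRealCLM.comp reCLM) + b • (ofRealCLM.comp imCLM)

lemma dC_apply (a b : ℂ) (v : ℂ) : dC a b v = a * v.re + b * v.im := by simp [dC]

/-- A solution in complex coordinates, with its partial derivatives up to order two. -/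
structure SolData (α K : ℝ) (U Ux Uy Uxx Uxy Uyy : ℂ → ℝ) : Prop where
  cxx : ContinuousOn Uxx (closedBall 0 1)
  cxy : ContinuousOn Uxy (closedBall 0 1)
  cyy : ContinuousOn Uyy (closedBall 0 1)
  dU : ∀ z ∈ closedBall (0:ℂ) 1, HasFDerivWithinAt U (dR (Ux z) (Uy z)) (closedBall 0 1) z
  dUx : ∀ z ∈ closedBall (0:ℂ) 1, HasFDerivWithinAt Ux (dR (Uxx z) (Uxy z)) (closedBall 0 1) z
  dUy : ∀ z ∈ closedBall (0:ℂ) 1, HasFDerivWithinAt Uy (dR (Uxy z) (Uyy z)) (closedBall 0 1) z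
  pde : ∀ z ∈ closedBall (0:ℂ) 1, Uxx z + Uyy z = -(K * ‖z‖ ^ α * Real.exp (U z))
  bd : ∀ z : ℂ, ‖z‖ = 1 → U z = 0
  pos : ∀ z ∈ ball (0:ℂ) 1, 0 < U z

/-- `∂u/∂z`. -/
def GG (Ux Uy : ℂ → ℝ) (z : ℂ) : ℂ := (Ux z - I * Uy z) / 2
/-- `∂²u/∂z²`. -/
def HH (Uxx Uxy Uyy : ℂ → ℝ) (z : ℂ) : ℂ := (Uxx z - Uyy z - 2 * I * Uxy z) / 4
/-- `∂²u/∂z∂z̄` as given by the equation. -/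
def LL (α K : ℝ) (U : ℂ → ℝ) (z : ℂ) : ℝ := -(K / 4 * ‖z‖ ^ α * Real.exp (U z))
/-- The holomorphic (Hopf type) quantity. -/
def JJ (α : ℝ) (Ux Uy Uxx Uxy Uyy : ℂ → ℝ) (z : ℂ) : ℂ :=
  z * (HH Uxx Uxy Uyy z - GG Ux Uy z ^ 2 / 2) - α / 2 * GG Ux Uy z

namespace SolData
variable {α K : ℝ} {U Ux Uy Uxx Uxy Uyy : ℂ → ℝ}

lemma nhd {z : ℂ} (hz : z ∈ ball (0:ℂ) 1) : closedBall (0:ℂ) 1 ∈ nhds z :=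
  Filter.mem_of_superset (Metric.isOpen_ball.mem_nhds hz) Metric.ball_subset_closedBall

lemma cU (h : SolData α K U Ux Uy Uxx Uxy Uyy) : ContinuousOn U (closedBall 0 1) :=
  fun z hz => (h.dU z hz).continuousWithinAt
lemma cUx (h : SolData α K U Ux Uy Uxx Uxy Uyy) : ContinuousOn Ux (closedBall 0 1) :=
  fun z hz => (h.dUx z hz).continuousWithinAt
lemma cUy (h : SolData α K U Ux Uy Uxx Uxy Uyy) : ContinuousOn Uy (closedBall 0 1) :=
  fun z hz => (h.dUy z hz).continuousWithinAt

lemma cG (h : SolData α K U Ux Uy Uxx Uxy Uyy) : ContinuousOn (GG Ux Uy) (closedBall 0 1) := by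
  have h1 : ContinuousOn (fun z => (Ux z : ℂ)) (closedBall 0 1) := Complex.continuous_ofReal.comp_continuousOn h.cUx
  have h2 : ContinuousOn (fun z => (Uy z : ℂ)) (closedBall 0 1) := Complex.continuous_ofReal.comp_continuousOn h.cUy
  unfold GG; fun_prop

lemma cH (h : SolData α K U Ux Uy Uxx Uxy Uyy) : ContinuousOn (HH Uxx Uxy Uyy) (closedBall 0 1) := by
  have h1 : ContinuousOn (fun z => (Uxx z : ℂ)) (closedBall 0 1) := Complex.continuous_ofReal.comp_continuousOn h.cxx
  have h2 : ContinuousOn (fun z => (Uxy z : ℂ)) (closedBall 0 1) := Complex.continuous_ofReal.comp_continuousOn h.cxy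
  have h3 : ContinuousOn (fun z => (Uyy z : ℂ)) (closedBall 0 1) := Complex.continuous_ofReal.comp_continuousOn h.cyy
  unfold HH; fun_prop

lemma cJ (h : SolData α K U Ux Uy Uxx Uxy Uyy) : ContinuousOn (JJ α Ux Uy Uxx Uxy Uyy) (closedBall 0 1) := by
  have h1 := h.cG
  have h2 := h.cH
  unfold JJ; fun_prop

lemma cL (hα : 0 < α) (h : SolData α K U Ux Uy Uxx Uxy Uyy) : ContinuousOn (LL α K U) (closedBall 0 1) := by
  have h1 := h.cU
  have h2 : Continuous fun z : ℂ => ‖z‖ ^ α := continuous_norm.rpow_const fun z => Or.inr hα.le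
  unfold LL
  exact ((continuousOn_const.mul h2.continuousOn).mul (Real.continuous_exp.comp_continuousOn h1)).neg

lemma dG (h : SolData α K U Ux Uy Uxx Uxy Uyy) {z : ℂ} (hz : z ∈ ball (0:ℂ) 1) :
    HasFDerivAt (GG Ux Uy) (dC (HH Uxx Uxy Uyy z + LL α K U z) (I * (HH Uxx Uxy Uyy z - LL α K U z))) z := by
  have hz' := Metric.ball_subset_closedBall hz
  have h1 := (h.dUx z hz').hasFDerivAt (nhd hz)
  have h2 := (h.dUy z hz').hasFDerivAt (nhd hz)
  have h1' := ofRealCLM.hasFDerivAt.comp z h1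
  have h2' := ofRealCLM.hasFDerivAt.comp z h2
  have h3 := (h1'.sub (h2'.const_mul I)).mul_const (1/2 : ℂ)
  have hp := h.pde z hz'
  have hL : LL α K U z = (Uxx z + Uyy z) / 4 := by rw [hp]; unfold LL; ring
  refine (h3.congr_fderiv ?_).congr_of_eventuallyEq (Filter.Eventually.of_forall fun w => ?_)
  · ext v
    all_goals simp [dC_apply, dR_apply, hL, HH]
    all_goals ring_nf
    all_goals simp
    all_goals ring
  · simp [GG]; ring

lemma dL (h : SolData α K U Ux Uy Uxx Uxy Uyy) {z : ℂ} (hz : z ∈ ball (0:ℂ) 1) (h0 : z ≠ 0) :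
    HasFDerivAt (LL α K U) (dR (LL α K U z * (α * z.re / ‖z‖^2 + Ux z)) (LL α K U z * (α * z.im / ‖z‖^2 + Uy z))) z := by
  have hz' := Metric.ball_subset_closedBall hz
  have h1 := (h.dU z hz').hasFDerivAt (nhd hz)
  have hn : ∀ w : ℂ, ‖w‖ ^ α = (w.re^2 + w.im^2) ^ (α/2) := by
    intro w
    have : w.re^2 + w.im^2 = ‖w‖^2 := by rw [Complex.sq_norm, Complex.normSq_apply]; ring
    rw [this, ← Real.rpow_natCast_mul (norm_nonneg _)]
    congr 1; push_cast; ring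
  have hn2 : ‖z‖^2 = z.re^2 + z.im^2 := by rw [Complex.sq_norm, Complex.normSq_apply]; ring
  have hpos : 0 < z.re^2 + z.im^2 := by rw [← hn2]; positivity
  have h2 : HasFDerivAt (fun w : ℂ => w.re^2 + w.im^2) (dR (2 * z.re) (2 * z.im)) z := by
    have r1 := reCLM.hasFDerivAt (x := z)
    have r2 := imCLM.hasFDerivAt (x := z)
    refine (((r1.mul r1).add (r2.mul r2)).congr_fderiv ?_).congr_of_eventuallyEq
      (Filter.Eventually.of_forall fun w => ?_)
    · ext v
      simp [dR_apply]
      ring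
    · simp; ring
  have h3 := h2.rpow_const (p := α/2) (Or.inl hpos.ne')
  have h4 := ((h3.const_mul (K/4)).mul h1.exp).neg
  refine (h4.congr_fderiv ?_).congr_of_eventuallyEq (Filter.Eventually.of_forall fun w => ?_)
  · ext v
    simp only [dR_apply, LL, hn, hn2]
    rw [Real.rpow_sub_one hpos.ne']
    simp [dR_apply]
    field_simp
    ring
  · simp [LL, hn]

set_option maxHeartbeats 2000000 in
lemma conservative (hα : 0 < α) (h : SolData α K U Ux Uy Uxx Uxy Uyy) :
    Complex.IsConservativeOn (JJ α Ux Uy Uxx Uxy Uyy) (ball 0 1) := by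
  intro z w hzw
  rw [← add_eq_zero_iff_eq_neg, Complex.wedgeIntegral_add_wedgeIntegral_eq]
  set J := JJ α Ux Uy Uxx Uxy Uyy with hJ
  set G := GG Ux Uy with hG
  set H := HH Uxx Uxy Uyy with hH
  set L : ℂ → ℂ := fun z => (LL α K U z : ℂ) with hL
  -- the two components of the auxiliary form
  set a1 : ℂ → ℂ := fun ζ => -(1 + α/2) * G ζ - ζ * L ζ - ζ * G ζ ^ 2 / 2 with ha1
  set b1 : ℂ → ℂ := fun ζ => -(I * (1 + α/2)) * G ζ + I * ζ * L ζ - I * ζ * G ζ ^ 2 / 2 with hb1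
  have hcL : ContinuousOn L (closedBall 0 1) := Complex.continuous_ofReal.comp_continuousOn (h.cL hα)
  have hcG : ContinuousOn G (closedBall 0 1) := h.cG
  have hcJ : ContinuousOn J (closedBall 0 1) := h.cJ
  have hca : ContinuousOn a1 (closedBall 0 1) := by rw [ha1]; fun_prop
  have hcb : ContinuousOn b1 (closedBall 0 1) := by rw [hb1]; fun_prop
  have hmem : ∀ x ∈ uIcc z.re w.re, ∀ y ∈ uIcc z.im w.im, ((x:ℂ) + y * I) ∈ ball (0:ℂ) 1 := by
    intro x hx y hy
    apply hzw
    rw [Complex.Rectangle, Complex.mem_reProdIm]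
    simpa using ⟨hx, hy⟩
  have hmemc : ∀ x ∈ uIcc z.re w.re, ∀ y ∈ uIcc z.im w.im, ((x:ℂ) + y * I) ∈ closedBall (0:ℂ) 1 :=
    fun x hx y hy => Metric.ball_subset_closedBall (hmem x hx y hy)
  have hdG : ∀ ζ ∈ ball (0:ℂ) 1, HasFDerivAt G (dC (H ζ + L ζ) (I * (H ζ - L ζ))) ζ := fun ζ hζ => h.dG hζ
  have hdzG : ∀ ζ ∈ ball (0:ℂ) 1, HasFDerivAt (fun ζ => ζ * G ζ) (dC (J ζ - a1 ζ) (I * J ζ - b1 ζ)) ζ := by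
    intro ζ hζ
    refine ((hasFDerivAt_id (𝕜 := ℝ) ζ).mul (hdG ζ hζ)).congr_fderiv ?_
    refine ContinuousLinearMap.ext fun v => ?_
    simp only [dC_apply, _root_.add_apply, _root_.smul_apply, smul_eq_mul,
      ContinuousLinearMap.id_apply, id]
    have hv := Complex.re_add_im v
    simp only [hJ, JJ, ← hG, ← hH, ha1, hb1]
    simp
    linear_combination - G ζ * hv
  have hor : ∀ y : ℝ, y ∈ uIcc z.im w.im → ∫ x in z.re..w.re, J (x + y * I) =
      ((w.re + y * I) * G (w.re + y * I) - (z.re + y * I) * G (z.re + y * I)) + ∫ x in z.re..w.re, a1 (x + y * I) := by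
    intro y hy
    have hl : ContinuousOn (fun x : ℝ => (x:ℂ) + y * I) (uIcc z.re w.re) := by fun_prop
    have iJ : IntervalIntegrable (fun x : ℝ => J (x + y * I)) volume z.re w.re :=
      (hcJ.comp hl fun x hx => hmemc x hx y hy).intervalIntegrable
    have ia : IntervalIntegrable (fun x : ℝ => a1 (x + y * I)) volume z.re w.re :=
      (hca.comp hl fun x hx => hmemc x hx y hy).intervalIntegrable
    have hd : ∀ x ∈ uIcc z.re w.re, HasDerivAt (fun x : ℝ => ((x:ℂ) + y * I) * G (x + y * I)) (J (x + y * I) - a1 (x + y * I)) x := by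
      intro x hx
      have h1 : HasDerivAt (fun x : ℝ => (x:ℂ) + y * I) 1 x := (Complex.ofRealCLM.hasDerivAt (x := x)).add_const _
      have := (hdzG _ (hmem x hx y hy)).comp_hasDerivAt x h1
      simpa [dC_apply, Function.comp_def] using this
    have := intervalIntegral.integral_eq_sub_of_hasDerivAt hd (iJ.sub ia)
    rw [← this, intervalIntegral.integral_sub iJ ia]
    ring
  have ver : ∀ x : ℝ, x ∈ uIcc z.re w.re → I • ∫ y in z.im..w.im, J (x + y * I) =
      ((x + w.im * I) * G (x + w.im * I) - (x + z.im * I) * G (x + z.im * I)) + ∫ y in z.im..w.im, b1 (x + y * I) := by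
    intro x hx
    have hl : ContinuousOn (fun y : ℝ => (x:ℂ) + y * I) (uIcc z.im w.im) := by fun_prop
    have iJ : IntervalIntegrable (fun y : ℝ => I * J (x + y * I)) volume z.im w.im :=
      ((hcJ.comp hl fun y hy => hmemc x hx y hy).intervalIntegrable).const_mul I
    have ia : IntervalIntegrable (fun y : ℝ => b1 (x + y * I)) volume z.im w.im :=
      (hcb.comp hl fun y hy => hmemc x hx y hy).intervalIntegrable
    have hd : ∀ y ∈ uIcc z.im w.im, HasDerivAt (fun y : ℝ => ((x:ℂ) + y * I) * G (x + y * I)) (I * J (x + y * I) - b1 (x + y * I)) y := by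
      intro y hy
      have h1 : HasDerivAt (fun y : ℝ => (x:ℂ) + y * I) I y := by
        simpa using ((Complex.ofRealCLM.hasDerivAt (x := y)).mul_const I).const_add (x:ℂ)
      have := (hdzG _ (hmem x hx y hy)).comp_hasDerivAt y h1
      simpa [dC_apply, Function.comp_def] using this
    have := intervalIntegral.integral_eq_sub_of_hasDerivAt hd (iJ.sub ia)
    rw [← this, intervalIntegral.integral_sub iJ ia, smul_eq_mul, intervalIntegral.integral_const_mul]
    ring
  rw [hor _ left_mem_uIcc, hor _ right_mem_uIcc, ver _ left_mem_uIcc, ver _ right_mem_uIcc]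
  -- divergence theorem
  set e : ℝ × ℝ →L[ℝ] ℂ := (Complex.equivRealProdCLM.symm : ℝ × ℝ →L[ℝ] ℂ) with he
  have he' : ∀ x y : ℝ, e (x, y) = x + y * I := by
    intro x y
    simp [he, Complex.ext_iff]
  set Lx : ℂ → ℂ := fun z => ((LL α K U z * (α * z.re / ‖z‖^2 + Ux z) : ℝ) : ℂ) with hLx
  set Ly : ℂ → ℂ := fun z => ((LL α K U z * (α * z.im / ‖z‖^2 + Uy z) : ℝ) : ℂ) with hLy
  have hdL : ∀ ζ ∈ ball (0:ℂ) 1, ζ ≠ 0 → HasFDerivAt L (dC (Lx ζ) (Ly ζ)) ζ := by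
    intro ζ hζ h0
    refine (ofRealCLM.hasFDerivAt.comp ζ (h.dL hζ h0)).congr_fderiv ?_
    refine ContinuousLinearMap.ext fun v => ?_
    simp [dC_apply, dR_apply, hLx, hLy]
  set a1x : ℂ → ℂ := fun ζ => -(1 + α/2) * (H ζ + L ζ) - (L ζ + ζ * Lx ζ) - (G ζ ^ 2 / 2 + ζ * G ζ * (H ζ + L ζ))
  set a1y : ℂ → ℂ := fun ζ => -(1 + α/2) * (I * (H ζ - L ζ)) - (I * L ζ + ζ * Ly ζ) - (I * G ζ ^ 2 / 2 + ζ * G ζ * (I * (H ζ - L ζ))) with ha1y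
  set b1x : ℂ → ℂ := fun ζ => -(I * (1 + α/2)) * (H ζ + L ζ) + I * (L ζ + ζ * Lx ζ) - I * (G ζ ^ 2 / 2 + ζ * G ζ * (H ζ + L ζ)) with hb1x
  set b1y : ℂ → ℂ := fun ζ => -(I * (1 + α/2)) * (I * (H ζ - L ζ)) + I * (I * L ζ + ζ * Ly ζ) - I * (I * G ζ ^ 2 / 2 + ζ * G ζ * (I * (H ζ - L ζ)))
  have hzz : ∀ v : ℂ, (v.re : ℂ) + v.im * I = v := Complex.re_add_im
  have hda : ∀ ζ ∈ ball (0:ℂ) 1, ζ ≠ 0 → HasFDerivAt a1 (dC (a1x ζ) (a1y ζ)) ζ := by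
    intro ζ hζ h0
    have g := hdG ζ hζ
    have l := hdL ζ hζ h0
    have i := hasFDerivAt_id (𝕜 := ℝ) ζ
    refine ((((g.const_mul (-(1 + (α:ℂ)/2))).sub (i.mul l)).sub ((i.mul (g.mul g)).mul_const (1/2 : ℂ))).congr_fderiv ?_).congr_of_eventuallyEq
      (Filter.Eventually.of_forall fun w => ?_)
    · refine ContinuousLinearMap.ext fun v => ?_
      have := hzz v
      simp [dC_apply, a1x, a1y]
      linear_combination (L ζ + G ζ ^ 2 / 2) * this
    · simp [a1]; ring
  have hdb : ∀ ζ ∈ ball (0:ℂ) 1, ζ ≠ 0 → HasFDerivAt b1 (dC (b1x ζ) (b1y ζ)) ζ := by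
    intro ζ hζ h0
    have g := hdG ζ hζ
    have l := hdL ζ hζ h0
    have i := hasFDerivAt_id (𝕜 := ℝ) ζ
    refine ((((g.const_mul (-(I * (1 + (α:ℂ)/2)))).add ((i.mul l).const_mul I)).sub ((i.mul (g.mul g)).mul_const (I/2 : ℂ))).congr_fderiv ?_).congr_of_eventuallyEq
      (Filter.Eventually.of_forall fun w => ?_)
    · refine ContinuousLinearMap.ext fun v => ?_
      have := hzz v
      simp [dC_apply, b1x, b1y]
      linear_combination (- I * L ζ + I * G ζ ^ 2 / 2) * this
    · simp [b1]; ring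
  have hdiv : ∀ ζ : ℂ, ζ ≠ 0 → b1x ζ - a1y ζ = 0 := by
    intro ζ h0
    have hn : (‖ζ‖:ℂ)^2 = (ζ.re:ℂ)^2 + (ζ.im:ℂ)^2 := by
      rw [← Complex.ofReal_pow, Complex.sq_norm, Complex.normSq_apply]; push_cast; ring
    have hn0 : (‖ζ‖:ℂ) ≠ 0 := by simpa using h0
    have key : ζ * (I * Lx ζ + Ly ζ) = I * α * L ζ + 2 * I * ζ * G ζ * L ζ := by
      have hc : ζ * ((ζ.re:ℂ) - I * ζ.im) = (‖ζ‖:ℂ)^2 := by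
        rw [hn]
        have := hzz ζ
        linear_combination -((ζ.re:ℂ) - I * ζ.im) * this - (ζ.im:ℂ)^2 * Complex.I_sq
      have e1 : I * Lx ζ + Ly ζ = L ζ * (I * (α * ((ζ.re:ℂ) - I * ζ.im) / (‖ζ‖:ℂ)^2 + 2 * G ζ)) := by
        simp only [hLx, hLy, hL, hG, GG]
        push_cast
        field_simp
        ring_nf
        simp
      rw [e1]
      have e2 : ζ * (L ζ * (I * (α * ((ζ.re:ℂ) - I * ζ.im) / (‖ζ‖:ℂ)^2 + 2 * G ζ))) =
        L ζ * I * (α * (ζ * ((ζ.re:ℂ) - I * ζ.im)) / (‖ζ‖:ℂ)^2 + 2 * ζ * G ζ) := by ring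
      rw [e2, hc]
      field_simp
    simp only [ha1y, hb1x]
    linear_combination key
  set s : Set (ℝ × ℝ) := {(0, 0)}
  set f' : ℝ × ℝ → ℝ × ℝ →L[ℝ] ℂ := fun p => (dC (b1x (e p)) (b1y (e p))).comp e with hf'
  set g' : ℝ × ℝ → ℝ × ℝ →L[ℝ] ℂ := fun p => -(dC (a1x (e p)) (a1y (e p))).comp e with hg'
  have hfg : ∀ p : ℝ × ℝ, p ≠ (0,0) → f' p (1, 0) + g' p (0, 1) = 0 := by
    rintro ⟨x, y⟩ hp
    have h0 : e (x, y) ≠ 0 := by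
      intro h0
      apply hp
      rw [he'] at h0
      have h1 := congrArg Complex.re h0
      have h2 := congrArg Complex.im h0
      simp at h1 h2
      rw [h1, h2]
    have := hdiv _ h0
    simp only [hf', hg', ContinuousLinearMap.comp_apply, _root_.neg_apply, he', dC_apply]
    rw [he'] at this
    simp
    linear_combination this
  have hae : ∀ᵐ p : ℝ × ℝ, p ≠ (0,0) := by
    have : (volume : Measure (ℝ × ℝ)) {(0,0)} = 0 := by simp
    exact measure_eq_zero_iff_ae_notMem.1 this
  have hec : Continuous e := e.continuous
  have hmaps : MapsTo e (uIcc z.re w.re ×ˢ uIcc z.im w.im) (closedBall 0 1) := by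
    rintro ⟨x, y⟩ ⟨hx, hy⟩
    rw [he']
    exact hmemc x hx y hy
  have hin : ∀ p ∈ Ioo (min z.re w.re) (max z.re w.re) ×ˢ Ioo (min z.im w.im) (max z.im w.im) \ s, e p ∈ ball (0:ℂ) 1 ∧ e p ≠ 0 := by
    rintro ⟨x, y⟩ ⟨⟨hx, hy⟩, hp⟩
    rw [he']
    refine ⟨hmem x (Ioo_subset_Icc_self hx) y (Ioo_subset_Icc_self hy), fun h0 => hp ?_⟩
    have h1 := congrArg Complex.re h0
    have h2 := congrArg Complex.im h0
    simp at h1 h2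
    simp [s, h1, h2]
  have hi : IntegrableOn (fun p => f' p (1, 0) + g' p (0, 1)) (uIcc z.re w.re ×ˢ uIcc z.im w.im) := by
    refine (integrableOn_zero (ε' := ℂ)).congr_fun_ae ?_
    refine ae_restrict_of_ae ?_
    filter_upwards [hae] with p hp
    exact (hfg p hp).symm
  have div := integral2_divergence_prod_of_hasFDerivAt_off_countable (fun p => b1 (e p)) (fun p => - a1 (e p))
    f' g' z.re z.im w.re w.im s (countable_singleton _) (hcb.comp hec.continuousOn hmaps) (hca.comp hec.continuousOn hmaps).neg
    (fun p hp => (hdb _ (hin p hp).1 (hin p hp).2).comp p e.hasFDerivAt)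
    (fun p hp => ((hda _ (hin p hp).1 (hin p hp).2).comp p e.hasFDerivAt).neg) hi
  have hz : (∫ x in z.re..w.re, ∫ y in z.im..w.im, f' (x, y) (1, 0) + g' (x, y) (0, 1)) = 0 := by
    refine (intervalIntegral.integral_congr_ae ?_).trans intervalIntegral.integral_zero
    have h0 : ∀ᵐ x : ℝ, x ≠ 0 := by
      exact measure_eq_zero_iff_ae_notMem.1 (by simp : (volume : Measure ℝ) {0} = 0)
    filter_upwards [h0] with x hx _
    have : ∀ y : ℝ, f' (x, y) (1, 0) + g' (x, y) (0, 1) = 0 := fun y => hfg (x,y) (by simp [hx])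
    simp [this]
  rw [hz] at div
  simp only [he', intervalIntegral.integral_neg] at div
  linear_combination -div

lemma holo (hα : 0 < α) (h : SolData α K U Ux Uy Uxx Uxy Uyy) :
    DiffContOnCl ℂ (JJ α Ux Uy Uxx Uxy Uyy) (ball 0 1) := by
  refine ⟨(Complex.isConservativeOn_and_continuousOn_iff_isDifferentiableOn Metric.isOpen_ball).1
    ⟨h.conservative hα, h.cJ.mono Metric.ball_subset_closedBall⟩, ?_⟩
  rw [closure_ball _ one_ne_zero]
  exact h.cJ


lemma dcirc {F : ℂ → ℝ} {a b : ℝ} (t : ℝ)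
    (hF : HasFDerivWithinAt F (dR a b) (closedBall 0 1) (circleMap 0 1 t)) :
    HasDerivAt (fun t => F (circleMap 0 1 t)) (a * (- Real.sin t) + b * Real.cos t) t := by
  have h1 := hasDerivAt_circleMap (0:ℂ) 1 t
  have hm : ∀ x : ℝ, circleMap 0 1 x ∈ closedBall (0:ℂ) 1 := fun x => by simp
  have h2 : HasDerivWithinAt (F ∘ circleMap 0 1) (dR a b (circleMap 0 1 t * I)) univ t :=
    hF.comp_hasDerivWithinAt t h1.hasDerivWithinAt (fun x _ => hm x)
  rw [hasDerivWithinAt_univ] at h2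
  refine h2.congr_deriv ?_
  rw [dR_apply]
  have e : circleMap 0 1 t = (⟨Real.cos t, Real.sin t⟩ : ℂ) := by
    apply Complex.ext <;> simp [circleMap, Complex.exp_ofReal_mul_I_re, Complex.exp_ofReal_mul_I_im]
  rw [e, Complex.mul_I_re, Complex.mul_I_im]

lemma boundary (h : SolData α K U Ux Uy Uxx Uxy Uyy) :
    ∃ q q' : ℝ → ℝ, (∀ t, HasDerivAt q (q' t) t) ∧ Continuous q' ∧
      (∀ t, circleMap 0 1 t * GG Ux Uy (circleMap 0 1 t) = ((q t / 2 : ℝ) : ℂ)) ∧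
      (∀ t, 8 * (circleMap 0 1 t * JJ α Ux Uy Uxx Uxy Uyy (circleMap 0 1 t)) =
        ((((2 + α)^2 - 2 * K) - ((2 + α) + q t)^2 : ℝ) : ℂ) - 4 * I * (q' t : ℂ)) := by
  have hm : ∀ x : ℝ, circleMap 0 1 x ∈ closedBall (0:ℂ) 1 := fun x => by simp
  have hcm : Continuous (circleMap (0:ℂ) 1) := continuous_circleMap 0 1
  have cc : ∀ {F : ℂ → ℝ}, ContinuousOn F (closedBall 0 1) → Continuous fun t => F (circleMap 0 1 t) :=
    fun hF => hF.comp_continuous hcm hm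
  set X := fun t => Ux (circleMap 0 1 t) with hX
  set Y := fun t => Uy (circleMap 0 1 t) with hY
  set XX := fun t => Uxx (circleMap 0 1 t) with hXX
  set XY := fun t => Uxy (circleMap 0 1 t) with hXY
  set YY := fun t => Uyy (circleMap 0 1 t) with hYY
  have c1 : Continuous X := cc h.cUx
  have c2 : Continuous Y := cc h.cUy
  have c3 : Continuous XX := cc h.cxx
  have c4 : Continuous XY := cc h.cxy
  have c5 : Continuous YY := cc h.cyy
  have dX : ∀ t, HasDerivAt X (XX t * (- Real.sin t) + XY t * Real.cos t) t := fun t => dcirc t (h.dUx _ (hm t))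
  have dY : ∀ t, HasDerivAt Y (XY t * (- Real.sin t) + YY t * Real.cos t) t := fun t => dcirc t (h.dUy _ (hm t))
  have T : ∀ t, X t * (- Real.sin t) + Y t * Real.cos t = 0 := by
    intro t
    have h1 := dcirc t (h.dU _ (hm t))
    have h2 : (fun t => U (circleMap 0 1 t)) = fun _ => 0 := by
      funext t; exact h.bd _ (by simp)
    rw [h2] at h1
    exact h1.unique (hasDerivAt_const t 0)
  have V : ∀ t, (XX t * (- Real.sin t) + XY t * Real.cos t) * (- Real.sin t) + X t * (- Real.cos t) +
      ((XY t * (- Real.sin t) + YY t * Real.cos t) * Real.cos t + Y t * (- Real.sin t)) = 0 := by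
    intro t
    have h1 := ((dX t).mul (Real.hasDerivAt_sin t).neg).add ((dY t).mul (Real.hasDerivAt_cos t))
    have h2 : (X * -Real.sin + Y * Real.cos) = fun _ => 0 := by
      funext t; exact T t
    rw [h2] at h1
    exact h1.unique (hasDerivAt_const t 0)
  refine ⟨fun t => X t * Real.cos t + Y t * Real.sin t,
    fun t => (XX t * (- Real.sin t) + XY t * Real.cos t) * Real.cos t + X t * (- Real.sin t) +
      ((XY t * (- Real.sin t) + YY t * Real.cos t) * Real.sin t + Y t * Real.cos t), ?_, ?_, ?_⟩
  · intro t
    exact ((dX t).mul (Real.hasDerivAt_cos t)).add ((dY t).mul (Real.hasDerivAt_sin t))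
  · fun_prop
  have hz : ∀ t, circleMap 0 1 t = (⟨Real.cos t, Real.sin t⟩ : ℂ) := by
    intro t
    apply Complex.ext <;> simp [circleMap, Complex.exp_ofReal_mul_I_re, Complex.exp_ofReal_mul_I_im]
  have e2 : ∀ t, circleMap 0 1 t * GG Ux Uy (circleMap 0 1 t) = (((X t * Real.cos t + Y t * Real.sin t) / 2 : ℝ) : ℂ) := by
    intro t
    have hG : GG Ux Uy (circleMap 0 1 t) = ⟨X t / 2, - Y t / 2⟩ := by
      apply Complex.ext <;> simp [GG, hX, hY]
    rw [hG, hz]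
    have := T t
    apply Complex.ext
    · rw [Complex.ofReal_re, Complex.mul_re]
      ring
    · rw [Complex.ofReal_im, Complex.mul_im]
      linear_combination (-1/2 : ℝ) * this
  refine ⟨e2, fun t => ?_⟩
  have N := Real.cos_sq_add_sin_sq t
  have P : XX t + YY t = -K := by
    have := h.pde _ (hm t)
    rw [h.bd _ (by simp)] at this
    simpa using this
  have hH : HH Uxx Uxy Uyy (circleMap 0 1 t) = ⟨(XX t - YY t) / 4, - XY t / 2⟩ := by
    apply Complex.ext
    · simp [HH, hXX, hYY]
    · simp [HH, hXY]; ring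
  have Tt := T t
  have Vt := V t
  set c := Real.cos t
  set s := Real.sin t
  set q := X t * c + Y t * s with hq
  set q' := (XX t * (- s) + XY t * c) * c + X t * (- s) + ((XY t * (- s) + YY t * c) * s + Y t * c) with hq'
  have e1 : 4 * (circleMap 0 1 t ^ 2 * HH Uxx Uxy Uyy (circleMap 0 1 t)) = ((-K - 2 * q : ℝ) : ℂ) - 2 * I * (q' : ℂ) := by
    rw [hH, hz]
    apply Complex.ext
    · simp [pow_two]
      linear_combination P * (c^2 + s^2) - K * N - 2 * Vt
    · simp [pow_two]
      linear_combination 2 * Tt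
  have e2t : circleMap 0 1 t * GG Ux Uy (circleMap 0 1 t) = ((q / 2 : ℝ) : ℂ) := e2 t
  have : 8 * (circleMap 0 1 t * JJ α Ux Uy Uxx Uxy Uyy (circleMap 0 1 t)) =
     2 * (4 * (circleMap 0 1 t ^ 2 * HH Uxx Uxy Uyy (circleMap 0 1 t))) - 4 * (circleMap 0 1 t * GG Ux Uy (circleMap 0 1 t))^2
      - 4 * α * (circleMap 0 1 t * GG Ux Uy (circleMap 0 1 t)) := by
    unfold JJ; ring
  show _ = (((2 + α)^2 - 2 * K - ((2 + α) + q)^2 : ℝ) : ℂ) - 4 * I * (q' : ℂ)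
  rw [this, e1, e2t]
  push_cast
  ring

lemma bounds (hα : 0 < α) (hK : 0 < K) (h : SolData α K U Ux Uy Uxx Uxy Uyy) :
    (∀ w ∈ ball (0:ℂ) 1, ‖JJ α Ux Uy Uxx Uxy Uyy w‖ ≤ Real.pi * (2 + α)^3 * (Real.sqrt (1 - ‖w‖))⁻¹) ∧
    (∀ z : ℂ, ‖z‖ = 1 → ‖GG Ux Uy z‖ ^ 2 ≤ (2 + α)^2 + Real.pi^2 * (2+α)^4) := by
  obtain ⟨q, q', hq, hq', hG, hJ⟩ := h.boundary
  set J := JJ α Ux Uy Uxx Uxy Uyy with hJdef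
  set A := (2 + α)^2 - 2 * K with hA
  set p := fun t => (2 + α) + q t with hp
  have hqc : Continuous q := continuous_iff_continuousAt.2 fun x => (hq x).continuousAt
  have hpc : Continuous p := by rw [hp]; fun_prop
  have hh : DiffContOnCl ℂ J (ball 0 1) := h.holo hα
  have hpi := Real.pi_pos
  have hz : ∀ t, circleMap 0 1 t * J (circleMap 0 1 t) = ((A - p t ^ 2 : ℝ) : ℂ) / 8 - I / 2 * (q' t : ℂ) := by
    intro t
    have := hJ t
    linear_combination this / 8
  have hcJ : Continuous fun t => ((A - p t ^ 2 : ℝ) : ℂ) / 8 - I / 2 * (q' t : ℂ) := by fun_prop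
  have h1 : ∫ x in (0:ℝ)..(2*Real.pi), (A - p x ^ 2) = 0 := by
    have h0 := hh.circleIntegral_eq_zero zero_le_one
    rw [circleIntegral] at h0
    have e : ∀ t, deriv (circleMap 0 1) t • J (circleMap 0 1 t) = I * (((A - p t ^ 2 : ℝ) : ℂ) / 8 - I / 2 * (q' t : ℂ)) := by
      intro t
      rw [← hz, deriv_circleMap]
      simp; ring
    simp only [e] at h0
    have h3 := congrArg Complex.imCLM h0
    rw [← ContinuousLinearMap.intervalIntegral_comp_comm _ ((by fun_prop : Continuous fun t => I * (((A - p t ^ 2 : ℝ) : ℂ) / 8 - I / 2 * (q' t : ℂ))).intervalIntegrable _ _)] at h3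
    have e2 : ∀ t, Complex.imCLM (I * (((A - p t ^ 2 : ℝ) : ℂ) / 8 - I / 2 * (q' t : ℂ))) = (1/8) * (A - p t ^2) := by
      intro t
      rw [show I * (((A - p t ^ 2 : ℝ) : ℂ) / 8 - I / 2 * (q' t : ℂ)) = ((q' t / 2 : ℝ) : ℂ) + (((A - p t ^ 2) / 8 : ℝ) : ℂ) * I by
        push_cast; linear_combination (- (q' t : ℂ) / 2) * Complex.I_sq]
      rw [Complex.imCLM_apply, Complex.add_im, Complex.ofReal_im, Complex.im_ofReal_mul, Complex.I_im]
      ring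
    simp only [e2, intervalIntegral.integral_const_mul, map_zero] at h3
    linarith
  have h2 : ∫ x in (0:ℝ)..(2*Real.pi), ((A - p x ^ 2)^2 - 16 * q' x ^ 2) = 0 := by
    have hd2 : DiffContOnCl ℂ (fun z => z * (J z * J z)) (ball 0 1) :=
      (differentiable_id.diffContOnCl).smul (hh.smul hh)
    have h0 := hd2.circleIntegral_eq_zero zero_le_one
    rw [circleIntegral] at h0
    have e : ∀ t, deriv (circleMap 0 1) t • (circleMap 0 1 t * (J (circleMap 0 1 t) * J (circleMap 0 1 t)))
        = I * (((A - p t ^ 2 : ℝ) : ℂ) / 8 - I / 2 * (q' t : ℂ))^2 := by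
      intro t
      rw [← hz, deriv_circleMap]
      simp; ring
    simp only [e] at h0
    have h3 := congrArg Complex.imCLM h0
    rw [← ContinuousLinearMap.intervalIntegral_comp_comm _ ((by fun_prop : Continuous fun t => I * (((A - p t ^ 2 : ℝ) : ℂ) / 8 - I / 2 * (q' t : ℂ))^2).intervalIntegrable _ _)] at h3
    have e2 : ∀ t, Complex.imCLM (I * (((A - p t ^ 2 : ℝ) : ℂ) / 8 - I / 2 * (q' t : ℂ))^2) = (1/64) * ((A - p t ^2)^2 - 16 * q' t ^ 2) := by
      intro t
      rw [show I * (((A - p t ^ 2 : ℝ) : ℂ) / 8 - I / 2 * (q' t : ℂ))^2 = (((A - p t ^ 2) * q' t / 8 : ℝ) : ℂ) + ((((A - p t ^ 2)^2 - 16 * q' t ^ 2) / 64 : ℝ) : ℂ) * I by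
        push_cast; linear_combination (- ((A:ℂ) - p t ^ 2) * (q' t : ℂ) / 8 + I * (q' t:ℂ)^2/4) * Complex.I_sq]
      rw [Complex.imCLM_apply, Complex.add_im, Complex.ofReal_im, Complex.im_ofReal_mul, Complex.I_im]
      ring
    simp only [e2, intervalIntegral.integral_const_mul, map_zero] at h3
    linarith
  obtain ⟨hE, hsup⟩ := flux_bound A ((2 + α)^2) (by positivity) (by rw [hA]; linarith) p q'
    (fun x => (hq x).const_add _) hq' h1 h2
  constructor
  · intro w hw
    have hw1 : ‖w‖ < 1 := by simpa using hw
    have hd2 : DiffContOnCl ℂ (fun z => J z * J z) (ball 0 1) := hh.smul hh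
    have h0 := hd2.circleIntegral_sub_inv_smul hw
    have hn : ∀ t, ‖J (circleMap 0 1 t)‖^2 = (1/64) * ((A - p t ^ 2)^2 + 16 * q' t ^ 2) := by
      intro t
      have e1 : ‖J (circleMap 0 1 t)‖ = ‖circleMap 0 1 t * J (circleMap 0 1 t)‖ := by simp
      rw [e1, hz, Complex.sq_norm, show ((A - p t ^ 2 : ℝ) : ℂ) / 8 - I / 2 * (q' t : ℂ) = (((A - p t ^ 2)/8 : ℝ) : ℂ) + ((- q' t/2 : ℝ) : ℂ) * I by
        push_cast; ring, Complex.normSq_add_mul_I]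
      ring
    have hI : ∫ t in (0:ℝ)..(2*Real.pi), ‖J (circleMap 0 1 t)‖^2 = (1/2) * ∫ x in (0:ℝ)..(2*Real.pi), q' x ^ 2 := by
      simp only [hn]
      have i1 : IntervalIntegrable (fun t => (1/64) * ((A - p t ^ 2)^2 - 16 * q' t ^ 2)) volume 0 (2*Real.pi) := Continuous.intervalIntegrable (by fun_prop) _ _
      have i2 : IntervalIntegrable (fun t => (1/2) * q' t ^ 2) volume 0 (2*Real.pi) := Continuous.intervalIntegrable (by fun_prop) _ _
      have : ∀ t, (1/64) * ((A - p t ^ 2)^2 + 16 * q' t ^ 2) = (1/64) * ((A - p t ^ 2)^2 - 16 * q' t ^ 2) + (1/2) * q' t ^ 2 := fun t => by ring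
      simp only [this]
      rw [intervalIntegral.integral_add i1 i2, intervalIntegral.integral_const_mul, intervalIntegral.integral_const_mul, h2]
      ring
    have hb : ‖∮ z in C(0, 1), (z - w)⁻¹ • (J z * J z)‖ ≤ (1 - ‖w‖)⁻¹ * ∫ t in (0:ℝ)..(2*Real.pi), ‖J (circleMap 0 1 t)‖^2 := by
      rw [circleIntegral, ← intervalIntegral.integral_const_mul]
      refine intervalIntegral.norm_integral_le_of_norm_le (by positivity) (Filter.Eventually.of_forall fun t _ => ?_) ?_
      · rw [deriv_circleMap]
        simp only [smul_eq_mul, norm_mul, norm_inv]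
        have e1 : ‖circleMap 0 1 t‖ = 1 := by simp
        rw [e1, Complex.norm_I]
        have e2 : 1 - ‖w‖ ≤ ‖circleMap 0 1 t - w‖ := by
          have h9 := norm_sub_norm_le (circleMap 0 1 t) w
          rw [e1] at h9; exact h9
        have e3 : ‖circleMap 0 1 t - w‖⁻¹ ≤ (1 - ‖w‖)⁻¹ := inv_anti₀ (by linarith) e2
        calc _ = ‖circleMap 0 1 t - w‖⁻¹ * ‖J (circleMap 0 1 t)‖^2 := by ring
          _ ≤ _ := by gcongr
      · simp only [hn]
        exact Continuous.intervalIntegrable (by fun_prop) _ _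
    rw [h0, hI] at hb
    have e4 : ‖((2 * Real.pi * I : ℂ) • (J w * J w))‖ = 2 * Real.pi * ‖J w‖^2 := by
      simp [abs_of_pos hpi]; ring
    rw [e4] at hb
    have hpos : 0 < 1 - ‖w‖ := by linarith
    have hb2 : 2 * Real.pi * ‖J w‖^2 ≤ (1 - ‖w‖)⁻¹ * ((1/2) * (Real.pi ^ 3 * ((2+α)^2)^3 / 8)) := by
      refine hb.trans ?_
      gcongr
    refine abs_le_of_sq_le_sq' ?_ (by positivity) |>.2
    rw [mul_pow, inv_pow, Real.sq_sqrt hpos.le]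
    have : 2 * Real.pi * ‖J w‖^2 ≤ 2 * Real.pi * ((Real.pi * (2+α)^3)^2 * (1 - ‖w‖)⁻¹) := by
      refine hb2.trans ?_
      have k : 0 < (1 - ‖w‖)⁻¹ * Real.pi ^ 3 * (2+α)^6 := by positivity
      nlinarith
    exact le_of_mul_le_mul_left this (by positivity)
  · intro z hz1
    have : z ∈ Set.image (circleMap 0 1) (Ioc 0 (2 * Real.pi)) := by
      rw [image_circleMap_Ioc]; simpa using hz1
    obtain ⟨t, ht, rfl⟩ := this
    have e1 : ‖GG Ux Uy (circleMap 0 1 t)‖ = ‖circleMap 0 1 t * GG Ux Uy (circleMap 0 1 t)‖ := by simp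
    rw [e1, hG, Complex.norm_real, Real.norm_eq_abs, sq_abs]
    have := hsup t ⟨ht.1.le, ht.2⟩
    simp only [hp] at this
    nlinarith [sq_nonneg (2 * (2 + α) + q t)]

lemma ray_alg (α K E F N T R L P : ℝ) (h1 : E * L = - (K / 4) * P * F) :
    E * (- (2 * T) / 2) * (N / 4) + E * (2 * R + N * T + α * N + 2 * L * T) / 4
      + K / 8 * (α * P * F + P * (F * (2 * T / 2))) =
    α * (E * N / 4 + K / 8 * P * F) + 1 / 2 * E * R := by
  linear_combination T / 2 * h1

lemma ray_deriv (h : SolData α K U Ux Uy Uxx Uxy Uyy) {e : ℂ} (he : ‖e‖ = 1) {r : ℝ} (hr : r ∈ Ioo (0:ℝ) 1) :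
    ∃ V' X' : ℝ, HasDerivAt (fun r : ℝ => U (r * e)) V' r ∧ |V'| ≤ 2 * ‖GG Ux Uy (r * e)‖ ∧
      HasDerivAt (fun r : ℝ => Real.exp (- U (r * e) / 2) * (‖GG Ux Uy (r * e)‖^2 / 4) +
        K / 8 * (r ^ α * Real.exp (U (r * e) / 2))) X' r ∧
      r * X' = α * (Real.exp (- U (r * e) / 2) * (‖GG Ux Uy (r * e)‖^2 / 4) +
        K / 8 * (r ^ α * Real.exp (U (r * e) / 2))) +
        1 / 2 * Real.exp (- U (r * e) / 2) * ((starRingEnd ℂ (GG Ux Uy (r * e))) * JJ α Ux Uy Uxx Uxy Uyy (r * e)).re := by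
  set z : ℂ := r * e with hz
  have hr0 := hr.1
  have hnz : ‖z‖ = r := by rw [hz, norm_mul, he, Complex.norm_real, Real.norm_eq_abs, abs_of_pos hr0, mul_one]
  have hzb : z ∈ ball (0:ℂ) 1 := by simpa [hnz] using hr.2
  have hline : HasDerivAt (fun r : ℝ => (r:ℂ) * e) e r := by
    simpa using (Complex.ofRealCLM.hasDerivAt (x := r)).mul_const e
  have dV : HasDerivAt (fun r : ℝ => U (r * e)) (dR (Ux z) (Uy z) e) r :=
    ((h.dU z (Metric.ball_subset_closedBall hzb)).hasFDerivAt (nhd hzb)).comp_hasDerivAt r hline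
  have dg : HasDerivAt (fun r : ℝ => GG Ux Uy (r * e)) (dC (HH Uxx Uxy Uyy z + LL α K U z) (I * (HH Uxx Uxy Uyy z - LL α K U z)) e) r :=
    by
    have h0 : HasFDerivAt (GG Ux Uy) (dC (HH Uxx Uxy Uyy z + LL α K U z) (I * (HH Uxx Uxy Uyy z - LL α K U z)))
      ((fun r : ℝ => (r:ℂ) * e) r) := h.dG hzb
    exact h0.comp_hasDerivAt r hline
  set V' := dR (Ux z) (Uy z) e with hV'
  set g' := dC (HH Uxx Uxy Uyy z + LL α K U z) (I * (HH Uxx Uxy Uyy z - LL α K U z)) e with hg'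
  set g := GG Ux Uy z with hg
  set H := HH Uxx Uxy Uyy z with hH
  set L := LL α K U z with hL
  set J := JJ α Ux Uy Uxx Uxy Uyy z with hJ
  have eV : V' = 2 * (e * g).re := by
    rw [hV', dR_apply, Complex.mul_re]
    have e1 : g.re = Ux z / 2 := by simp [hg, GG]
    have e2 : g.im = - Uy z / 2 := by simp [hg, GG]
    rw [e1, e2]; ring
  have eg : (r:ℂ) * g' = J + z * g^2 / 2 + α / 2 * g + starRingEnd ℂ z * L := by
    have e1 : g' = e * H + starRingEnd ℂ e * L := by
      rw [hg', dC_apply]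
      have ee := Complex.re_add_im e
      have ec : starRingEnd ℂ e = e.re - e.im * I := by apply Complex.ext <;> simp
      rw [ec]
      linear_combination H * ee
    rw [e1, hJ, JJ, hz, ← hz, ← hg, ← hH]
    simp only [hz, map_mul, Complex.conj_ofReal]
    ring
  have dre : HasDerivAt (fun r : ℝ => (GG Ux Uy (r * e)).re) g'.re r :=
    Complex.reCLM.hasFDerivAt.comp_hasDerivAt r dg
  have dim : HasDerivAt (fun r : ℝ => (GG Ux Uy (r * e)).im) g'.im r :=
    Complex.imCLM.hasFDerivAt.comp_hasDerivAt r dg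
  have dN : HasDerivAt (fun r : ℝ => ‖GG Ux Uy (r * e)‖^2) (2 * (g.re * g'.re + g.im * g'.im)) r := by
    have := (dre.mul dre).add (dim.mul dim)
    refine (this.congr_deriv ?_).congr_of_eventuallyEq (Filter.Eventually.of_forall fun x => ?_)
    · show g'.re * g.re + g.re * g'.re + (g'.im * g.im + g.im * g'.im) = _
      ring
    · show ‖GG Ux Uy (x * e)‖^2 = _
      rw [Complex.sq_norm, Complex.normSq_apply]; rfl
  have dP : HasDerivAt (fun r : ℝ => r ^ α) (α * r ^ (α - 1)) r :=
    Real.hasDerivAt_rpow_const (Or.inl hr0.ne')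
  have dE := (dV.neg.div_const 2).exp
  have dF := (dV.div_const 2).exp
  have dX := (dE.mul (dN.div_const 4)).add ((dP.mul dF).const_mul (K/8))
  refine ⟨V', _, dV, ?_, dX, ?_⟩
  · rw [eV, abs_mul, abs_two]
    have := Complex.abs_re_le_norm (e * g)
    rw [norm_mul, he, one_mul] at this
    linarith
  · have hrV : r * V' = 2 * (z * g).re := by
      rw [eV, hz, mul_assoc (r:ℂ), Complex.re_ofReal_mul]; ring
    have hP : r * r ^ (α - 1) = r ^ α := by
      rw [Real.rpow_sub_one hr0.ne']; field_simp
    have hN : r * (2 * (g.re * g'.re + g.im * g'.im)) = 2 * ((starRingEnd ℂ g) * J).re + ‖g‖^2 * (z * g).re + α * ‖g‖^2 + 2 * L * (z * g).re := by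
      have e1 := congrArg Complex.re eg
      have e2 := congrArg Complex.im eg
      rw [Complex.re_ofReal_mul] at e1
      rw [Complex.im_ofReal_mul] at e2
      have e3 : (J + z * g^2 / 2 + α / 2 * g + starRingEnd ℂ z * L).re = J.re + (z.re * (g.re^2 - g.im^2) - z.im * (2 * g.re * g.im)) / 2 + α / 2 * g.re + z.re * L := by
        simp [pow_two]; left; ring
      have e4 : (J + z * g^2 / 2 + α / 2 * g + starRingEnd ℂ z * L).im = J.im + (z.im * (g.re^2 - g.im^2) + z.re * (2 * g.re * g.im)) / 2 + α / 2 * g.im - z.im * L := by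
        simp [pow_two]; ring
      rw [e3] at e1
      rw [e4] at e2
      rw [Complex.sq_norm, Complex.normSq_apply, Complex.mul_re, Complex.mul_re, Complex.conj_re, Complex.conj_im]
      linear_combination 2 * g.re * e1 + 2 * g.im * e2
    have hE : Real.exp (-U z / 2) * L = - (K / 4) * r ^ α * Real.exp (U z / 2) := by
      have : Real.exp (-U z / 2) * Real.exp (U z) = Real.exp (U z / 2) := by
        rw [← Real.exp_add]; congr 1; ring
      rw [hL, LL, hnz, ← this]; ring
    have key := ray_alg α K (Real.exp (-U z / 2)) (Real.exp (U z / 2)) (‖g‖^2) ((z * g).re) (((starRingEnd ℂ g) * J).re) L (r ^ α) hE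
    rw [← hrV, ← hN, ← hP] at key
    rw [← hP]
    simp only [Pi.neg_apply, ← hz, ← hg]
    linear_combination key

lemma ray (hα : 0 < α) {K1 K2 : ℝ} (hK1 : 0 < K1) :
    ∃ c > 0, ∀ (K : ℝ) (U Ux Uy Uxx Uxy Uyy : ℂ → ℝ), K1 ≤ K → K ≤ K2 → SolData α K U Ux Uy Uxx Uxy Uyy →
      ∀ z ∈ ball (0:ℂ) 1, z ≠ 0 → c ≤ Real.exp (- U z / 4) := by
  have hpi := Real.pi_pos
  by_cases hK12 : K1 ≤ K2
  swap
  · exact ⟨1, one_pos, fun K _ _ _ _ _ _ h1 h2 => absurd (h1.trans h2) hK12⟩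
  have hK2 : 0 < K2 := hK1.trans_le hK12
  obtain ⟨c, hc, hcc⟩ := ray_bound α (Real.pi * (2 + α)^3) (Real.sqrt (((2 + α)^2 + Real.pi^2 * (2+α)^4) / 4 + K2 / 8))
    (Real.sqrt (K1 / 8)) hα (by positivity) (by positivity) (by positivity)
  refine ⟨c, hc, fun K U Ux Uy Uxx Uxy Uyy h1 h2 h z hz hz0 => ?_⟩
  have hK : 0 < K := hK1.trans_le h1
  obtain ⟨bJ, bG⟩ := h.bounds hα hK
  set e : ℂ := z / ‖z‖ with he
  have hzn : 0 < ‖z‖ := norm_pos_iff.2 hz0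
  have he1 : ‖e‖ = 1 := by
    rw [he, norm_div, Complex.norm_real, norm_norm, div_self hzn.ne']
  have hze : ((‖z‖ : ℝ) : ℂ) * e = z := by
    have : ((‖z‖ : ℝ) : ℂ) ≠ 0 := by exact_mod_cast hzn.ne'
    rw [he]; field_simp
  have hz1 : ‖z‖ < 1 := by simpa using hz
  have hnr : ∀ r : ℝ, 0 < r → ‖(r:ℂ) * e‖ = r := fun r hr => by
    rw [norm_mul, he1, Complex.norm_real, Real.norm_eq_abs, abs_of_pos hr, mul_one]
  have hD : ∀ r ∈ Ioo (0:ℝ) 1, _ := fun r hr => h.ray_deriv he1 hr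
  choose! V' X' dV bV dX eX using hD
  set X := fun r : ℝ => Real.exp (- U (r * e) / 2) * (‖GG Ux Uy (r * e)‖^2 / 4) +
        K / 8 * (r ^ α * Real.exp (U (r * e) / 2)) with hX
  have Xpos : ∀ r : ℝ, 0 < r → 0 < X r := fun r hr => by
    simp only [hX]
    have : 0 < r ^ α := Real.rpow_pos_of_pos hr _
    positivity
  set f := fun r : ℝ => Real.exp (- U (r * e) / 4) with hf
  have hfpos : ∀ r, 0 < f r := fun r => Real.exp_pos _
  have hff : ∀ r, f r ^ 2 = Real.exp (- U (r * e) / 2) := fun r => by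
    simp only [hf]; rw [pow_two, ← Real.exp_add]; congr 1; ring
  have hsg : ∀ r ∈ Ioo (0:ℝ) 1, f r * ‖GG Ux Uy (r * e)‖ / 2 ≤ Real.sqrt (X r) := by
    intro r hr
    apply Real.le_sqrt_of_sq_le
    have : 0 < r ^ α := Real.rpow_pos_of_pos hr.1 _
    have : 0 ≤ K / 8 * (r ^ α * Real.exp (U (r * e) / 2)) := by positivity
    rw [div_pow, mul_pow, hff]
    simp only [hX]
    linarith
  have main := hcc f (fun r => Real.sqrt (X r)) (fun r => f r * (- V' r / 4)) (fun r => X' r / (2 * Real.sqrt (X r)))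
    (fun r hr => ((dV r hr).neg.div_const 4).exp) (fun r hr => (dX r hr).sqrt (Xpos r hr.1).ne')
    ?_ (fun r _ => hfpos r) ?_ (fun r hr => Real.sqrt_pos.2 (Xpos r hr.1)) ?_ ?_ ?_ ?_ ‖z‖ ⟨hzn, hz1⟩
  · simp only [hf] at main
    rw [hze] at main
    exact main
  · -- continuity
    have hm : MapsTo (fun r : ℝ => (r:ℂ) * e) (Ioc 0 1) (closedBall 0 1) := by
      intro r hr
      simp only [mem_closedBall_zero_iff]
      rw [hnr r hr.1]; exact hr.2
    have hl : ContinuousOn (fun r : ℝ => (r:ℂ) * e) (Ioc 0 1) := by fun_prop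
    have c1 : ContinuousOn (fun r : ℝ => U (r * e)) (Ioc 0 1) := h.cU.comp hl hm
    have c2 : ContinuousOn (fun r : ℝ => GG Ux Uy (r * e)) (Ioc 0 1) := h.cG.comp hl hm
    have c3 : Continuous (fun r : ℝ => r ^ α) := continuous_id.rpow_const fun z => Or.inr hα.le
    apply ContinuousOn.sqrt
    exact ((c1.neg.div_const 2).rexp.mul ((c2.norm.pow 2).div_const 4)).add
      (continuousOn_const.mul (c3.continuousOn.mul (c1.div_const 2).rexp))
  · intro r hr
    simp only [hf]
    rw [Real.exp_le_one_iff]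
    have := h.pos (r * e) (by rw [mem_ball_zero_iff, hnr r hr.1]; exact hr.2)
    linarith
  · intro r hr
    rw [abs_mul, abs_of_pos (hfpos r)]
    refine le_trans ?_ (hsg r hr)
    rw [abs_div, abs_neg]
    have := bV r hr
    rw [show |(4:ℝ)| = 4 by norm_num, mul_div_assoc]
    have h5 := hfpos r
    have h6 : |V' r| / 4 ≤ ‖GG Ux Uy (r * e)‖ / 2 := by linarith
    exact mul_le_mul_of_nonneg_left h6 h5.le
  · intro r hr
    have hs : 0 < Real.sqrt (X r) := Real.sqrt_pos.2 (Xpos r hr.1)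
    set s := Real.sqrt (X r) with hsdef
    have hss : s ^ 2 = X r := Real.sq_sqrt (Xpos r hr.1).le
    have e1 := eX r hr
    have e2 : |((starRingEnd ℂ (GG Ux Uy (r * e))) * JJ α Ux Uy Uxx Uxy Uyy (r * e)).re| ≤ ‖GG Ux Uy (r * e)‖ * ‖JJ α Ux Uy Uxx Uxy Uyy (r * e)‖ := by
      refine (Complex.abs_re_le_norm _).trans ?_
      rw [norm_mul, Complex.norm_conj]
    have e3 := bJ (r * e) (by rw [mem_ball_zero_iff, hnr r hr.1]; exact hr.2)
    rw [hnr r hr.1] at e3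
    have e4 := hsg r hr
    set Q := ((starRingEnd ℂ (GG Ux Uy (r * e))) * JJ α Ux Uy Uxx Uxy Uyy (r * e)).re
    set M := Real.pi * (2 + α) ^ 3 * (√(1 - r))⁻¹ with hM
    have hMM : Real.pi * (2 + α) ^ 3 / 2 * (√(1 - r))⁻¹ = M / 2 := by rw [hM]; ring
    rw [hMM]
    have h5 := hfpos r
    have e6 : - Q ≤ ‖GG Ux Uy (r * e)‖ * M := by
      calc -Q ≤ |Q| := neg_le_abs Q
        _ ≤ _ := e2
        _ ≤ _ := by gcongr
    have hMn : 0 ≤ M := (norm_nonneg _).trans e3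
    have e7 : - (1 / 2 * Real.exp (- U (r * e) / 2) * Q) ≤ s * (M * f r) := by
      rw [← hff]
      calc _ = 1 / 2 * f r ^ 2 * (-Q) := by ring
        _ ≤ 1 / 2 * f r ^ 2 * (‖GG Ux Uy (r * e)‖ * M) := by gcongr
        _ = (f r * ‖GG Ux Uy (r * e)‖ / 2) * (M * f r) := by ring
        _ ≤ _ := by gcongr
    have e8 : r * X' r ≥ α * s ^ 2 - s * (M * f r) := by
      rw [hss, e1]; simp only [hX]; linarith
    rw [← mul_div_assoc, le_div_iff₀ (by positivity)]
    nlinarith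
  · apply Real.sqrt_le_sqrt
    have e1 : ‖((1:ℝ):ℂ) * e‖ = 1 := hnr 1 one_pos
    simp only [hX]
    rw [h.bd _ e1]
    have := bG _ e1
    simp only [neg_zero, zero_div, Real.exp_zero, Real.one_rpow]
    linarith
  · intro r hr
    have hP : 0 < r ^ α := Real.rpow_pos_of_pos hr.1 _
    have h5 := hfpos r
    have h6 : Real.sqrt (K / 8) * r ^ (α / 2) ≤ Real.sqrt (X r) * f r := by
      have h7 : 0 ≤ r ^ (α / 2) := Real.rpow_nonneg hr.1.le _
      refine (sq_le_sq₀ (by positivity) (by positivity)).1 ?_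
      rw [mul_pow, mul_pow, Real.sq_sqrt (by positivity), Real.sq_sqrt (Xpos r hr.1).le, hff]
      have e1 : (r ^ (α / 2)) ^ 2 = r ^ α := by
        rw [← Real.rpow_natCast, ← Real.rpow_mul hr.1.le]; congr 1; push_cast; ring
      have e2 : Real.exp (U (r * e) / 2) * Real.exp (-U (r * e) / 2) = 1 := by
        rw [← Real.exp_add, ← Real.exp_zero]; congr 1; ring
      rw [e1]
      simp only [hX]
      have e3 : 0 ≤ Real.exp (- U (r * e) / 2) * (‖GG Ux Uy (r * e)‖^2 / 4) * Real.exp (- U (r * e) / 2) := by positivity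
      linear_combination e3 - K / 8 * r ^ α * e2
    refine le_trans ?_ h6
    have h7 : 0 ≤ r ^ (α / 2) := Real.rpow_nonneg hr.1.le _
    gcongr

end SolData

lemma lineDeriv2 {U : ℂ → ℝ} (hU : ContDiffOn ℝ 2 U (closedBall 0 1)) {z : ℂ} (hz : z ∈ ball (0:ℂ) 1) (v : ℂ) :
    deriv (deriv (fun t : ℝ => U (z + t • v))) 0 =
      fderivWithin ℝ (fderivWithin ℝ U (closedBall 0 1)) (closedBall 0 1) z v v := by
  have hud : UniqueDiffOn ℝ (closedBall (0:ℂ) 1) := uniqueDiffOn_convex (convex_closedBall 0 1) ⟨0, by rw [interior_closedBall _ one_ne_zero]; simp⟩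
  have hF : ContDiffOn ℝ 1 (fderivWithin ℝ U (closedBall 0 1)) (closedBall 0 1) :=
    hU.fderivWithin hud (by norm_num)
  have hl : ∀ t : ℝ, HasDerivAt (fun t : ℝ => z + t • v) v t := fun t => by
    simpa using ((hasDerivAt_id t).smul_const v).const_add z
  have hev : ∀ᶠ t : ℝ in nhds 0, z + t • v ∈ ball (0:ℂ) 1 := by
    have hc : ContinuousAt (fun t : ℝ => z + t • v) 0 := (hl 0).continuousAt
    apply hc.eventually_mem
    simpa using Metric.isOpen_ball.mem_nhds hz
  have h1 : deriv (fun t : ℝ => U (z + t • v)) =ᶠ[nhds 0] fun t => fderivWithin ℝ U (closedBall 0 1) (z + t • v) v := by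
    filter_upwards [hev] with t ht
    have := ((hU.differentiableOn (by norm_num) _ (Metric.ball_subset_closedBall ht)).hasFDerivWithinAt).hasFDerivAt (SolData.nhd ht)
    exact (this.comp_hasDerivAt t (hl t)).deriv
  rw [h1.deriv_eq]
  have h2 : HasFDerivAt (fderivWithin ℝ U (closedBall 0 1)) (fderivWithin ℝ (fderivWithin ℝ U (closedBall 0 1)) (closedBall 0 1) z)
      ((fun t : ℝ => z + t • v) 0) := by
    simpa using ((hF.differentiableOn (by norm_num) _ (Metric.ball_subset_closedBall hz)).hasFDerivWithinAt).hasFDerivAt (SolData.nhd hz)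
  have h3 := h2.comp_hasDerivAt 0 (hl 0)
  exact (h3.clm_apply (hasDerivAt_const (0:ℝ) v)).deriv.trans (by simp)

lemma dR_of (A : ℂ →L[ℝ] ℝ) : A = dR (A 1) (A I) := by
  ext v
  rw [dR_apply]
  conv_lhs => rw [← Complex.re_add_im v]
  rw [map_add, show (v.re : ℂ) = v.re • (1:ℂ) by simp, show (v.im : ℂ) * I = v.im • I by simp, map_smul, map_smul]
  simp only [smul_eq_mul]
  ring

lemma mk_solData {α K : ℝ} (hα : 0 < α) {U : ℂ → ℝ} (hU : ContDiffOn ℝ 2 U (closedBall 0 1))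
    (pos : ∀ z ∈ ball (0:ℂ) 1, 0 < U z) (bd : ∀ z : ℂ, ‖z‖ = 1 → U z = 0)
    (pde : ∀ z ∈ ball (0:ℂ) 1, deriv (deriv (fun t : ℝ => U (z + t • (1:ℂ)))) 0 + deriv (deriv (fun t : ℝ => U (z + t • I))) 0
      = -(K * ‖z‖ ^ α * Real.exp (U z))) :
    ∃ Ux Uy Uxx Uxy Uyy, SolData α K U Ux Uy Uxx Uxy Uyy := by
  have hud : UniqueDiffOn ℝ (closedBall (0:ℂ) 1) := uniqueDiffOn_convex (convex_closedBall 0 1) ⟨0, by rw [interior_closedBall _ one_ne_zero]; simp⟩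
  set F := fderivWithin ℝ U (closedBall 0 1) with hFdef
  have hF : ContDiffOn ℝ 1 F (closedBall 0 1) := hU.fderivWithin hud (by norm_num)
  set FF := fderivWithin ℝ F (closedBall 0 1) with hFFdef
  have cFF : ContinuousOn FF (closedBall 0 1) := hF.continuousOn_fderivWithin hud (by norm_num)
  have hsym : ∀ z ∈ closedBall (0:ℂ) 1, FF z I 1 = FF z 1 I := by
    intro z hz
    have := (hU z hz).isSymmSndFDerivWithinAt (by simp) hud (by
      rw [interior_closedBall _ one_ne_zero, closure_ball _ one_ne_zero]; exact hz) hz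
    exact this.eq I 1
  have c2 : ∀ v w : ℂ, ContinuousOn (fun z => FF z v w) (closedBall 0 1) := fun v w =>
    (cFF.clm_apply continuousOn_const).clm_apply continuousOn_const
  have d2 : ∀ w : ℂ, ∀ z ∈ closedBall (0:ℂ) 1, HasFDerivWithinAt (fun z => F z w) (dR (FF z 1 w) (FF z I w)) (closedBall 0 1) z := by
    intro w z hz
    have h1 := (hF.differentiableOn (by norm_num) _ hz).hasFDerivWithinAt
    have h2 := h1.clm_apply (hasFDerivWithinAt_const w z _)
    refine h2.congr_fderiv ?_
    rw [dR_of (_ + _)]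
    simp [hFFdef]
  have hp : ∀ z ∈ ball (0:ℂ) 1, FF z 1 1 + FF z I I = -(K * ‖z‖ ^ α * Real.exp (U z)) := by
    intro z hz
    rw [← pde z hz, lineDeriv2 hU hz, lineDeriv2 hU hz]
  refine ⟨fun z => F z 1, fun z => F z I, fun z => FF z 1 1, fun z => FF z 1 I, fun z => FF z I I,
    c2 _ _, c2 _ _, c2 _ _, ?_, ?_, d2 I, ?_, bd, pos⟩
  · intro z hz
    have h1 := (hU.differentiableOn (by norm_num) _ hz).hasFDerivWithinAt
    rw [← dR_of]
    exact h1
  · intro z hz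
    have := d2 1 z hz
    rwa [hsym z hz] at this
  · have hcl : closedBall (0:ℂ) 1 = closure (ball 0 1) := (closure_ball _ one_ne_zero).symm
    have c3 : Continuous fun z : ℂ => ‖z‖ ^ α := continuous_norm.rpow_const fun z => Or.inr hα.le
    have cl : ContinuousOn (fun z => FF z 1 1 + FF z I I) (closedBall 0 1) := (c2 _ _).add (c2 _ _)
    have cr : ContinuousOn (fun z => -(K * ‖z‖ ^ α * Real.exp (U z))) (closedBall 0 1) :=
      ((continuousOn_const.mul c3.continuousOn).mul hU.continuousOn.rexp).neg
    have he : EqOn (fun z => FF z 1 1 + FF z I I) (fun z => -(K * ‖z‖ ^ α * Real.exp (U z))) (ball 0 1) := hp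
    exact he.of_subset_closure cl cr Metric.ball_subset_closedBall hcl.le

lemma final_bound {α : ℝ} (hα : 0 < α) {K1 K2 : ℝ} (hK1 : 0 < K1) :
    ∃ C > 0, ∀ (K : ℝ) (U Ux Uy Uxx Uxy Uyy : ℂ → ℝ), K1 ≤ K → K ≤ K2 → SolData α K U Ux Uy Uxx Uxy Uyy →
      ∀ z ∈ ball (0:ℂ) 1, U z ≤ C := by
  obtain ⟨c, hc, hcc⟩ := SolData.ray (K2 := K2) hα hK1
  refine ⟨max 1 (-4 * Real.log c), by positivity, fun K U Ux Uy Uxx Uxy Uyy h1 h2 h => ?_⟩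
  have key : ∀ z ∈ ball (0:ℂ) 1, z ≠ 0 → U z ≤ max 1 (-4 * Real.log c) := by
    intro z hz hz0
    have h3 := hcc K U Ux Uy Uxx Uxy Uyy h1 h2 h z hz hz0
    have h4 := (Real.log_le_iff_le_exp hc).2 h3
    refine le_trans ?_ (le_max_right _ _)
    linarith
  intro z hz
  by_cases hz0 : z = 0
  swap
  · exact key z hz hz0
  subst hz0
  have hcont : ContinuousAt U 0 := (h.cU 0 (Metric.ball_subset_closedBall hz)).continuousAt (SolData.nhd hz)
  have ht : Filter.Tendsto U (nhdsWithin 0 {0}ᶜ) (nhds (U 0)) := hcont.tendsto.mono_left nhdsWithin_le_nhds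
  refine le_of_tendsto ht ?_
  filter_upwards [self_mem_nhdsWithin, nhdsWithin_le_nhds (Metric.isOpen_ball.mem_nhds hz)] with w hw hw2
  exact key w hw2 hw

/-- uniform a priori `L^∞` bound: for fixed `α > 0` and `0 < c₁ ≤ c₂`,
there is `C > 0` such that every positive `C²` solution of
`−Δu = ((2+α)/2)² λ |x|^α e^u` in the unit ball with zero boundary data and
`λ ∈ [c₁, c₂]` satisfies `u ≤ C` in the ball. -/
theorem stmt_17 (α : ℝ) (hα : 0 < α) (c₁ c₂ : ℝ) (hc : 0 < c₁ ∧ c₁ ≤ c₂) :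
    ∃ C : ℝ, 0 < C ∧
      ∀ lam ∈ Set.Icc c₁ c₂, ∀ u : EuclideanSpace ℝ (Fin 2) → ℝ,
        ContDiffOn ℝ 2 u (Metric.closedBall (0 : EuclideanSpace ℝ (Fin 2)) 1) →
        (∀ x ∈ Metric.ball (0 : EuclideanSpace ℝ (Fin 2)) 1, 0 < u x) →
        (∀ x : EuclideanSpace ℝ (Fin 2), ‖x‖ = 1 → u x = 0) →
        (∀ x ∈ Metric.ball (0 : EuclideanSpace ℝ (Fin 2)) 1,
          -planeLaplacian u x = ((2 + α) / 2) ^ 2 * lam * ‖x‖ ^ α * Real.exp (u x)) →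
        ∀ x ∈ Metric.ball (0 : EuclideanSpace ℝ (Fin 2)) 1, u x ≤ C := by
  obtain ⟨hc1, hc2⟩ := hc
  obtain ⟨C, hC, hCC⟩ := final_bound hα (K1 := ((2 + α) / 2) ^ 2 * c₁) (K2 := ((2 + α) / 2) ^ 2 * c₂) (by positivity)
  refine ⟨C, hC, fun lam hlam u hu hpos hbd hpde x hx => ?_⟩
  set φ : ℂ ≃ₗᵢ[ℝ] EuclideanSpace ℝ (Fin 2) := Complex.orthonormalBasisOneI.repr with hφ
  have e0 : φ 1 = EuclideanSpace.single 0 1 := by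
    ext i; fin_cases i <;> simp [hφ]
  have e1 : φ I = EuclideanSpace.single 1 1 := by
    ext i; fin_cases i <;> simp [hφ]
  have hb : ∀ z ∈ ball (0:ℂ) 1, φ z ∈ Metric.ball (0 : EuclideanSpace ℝ (Fin 2)) 1 := by
    intro z hz; simpa using hz
  have hU : ContDiffOn ℝ 2 (fun z => u (φ z)) (closedBall 0 1) := by
    refine hu.comp φ.toContinuousLinearEquiv.contDiff.contDiffOn ?_
    intro z hz
    simpa using hz
  obtain ⟨Ux, Uy, Uxx, Uxy, Uyy, h⟩ := mk_solData (K := ((2 + α) / 2) ^ 2 * lam) hα hU (fun z hz => hpos _ (hb z hz))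
    (fun z hz => hbd _ (by simpa using hz)) (by
      intro z hz
      have := hpde _ (hb z hz)
      rw [φ.norm_map] at this
      rw [← this, neg_neg, planeLaplacian, Fin.sum_univ_two]
      simp only [map_add, map_smul, e0, e1])
  have := hCC _ _ _ _ _ _ _ (by gcongr; exact hlam.1) (by gcongr; exact hlam.2) h (φ.symm x) (by simpa using hx)
  simpa using this

end
end

section
/- Let β ≥ 0 be a real number and suppose η : (0,∞) → ℝ is twice differentiable, bounded on (0,1), not identically zero, satisfies −η''(r) − (1/r)η'(r) + (β²/r²)η(r) = (8/(1 + r²)²)·η(r) for all r ∈ (0,∞), ∫₀^∞ r·η'(r)² dr < ∞, and additionally η(r) → 0 as r → 0⁺ in case β > 0. Then either β = 0 and there is c ≠ 0 with η(r) = c·(1 − r²)/(1 + r²) for all r > 0, or β = 1 and there is c ≠ 0 with η(r) = c·r/(1 + r²) for all r > 0. -/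
open Set MeasureTheory Filter

namespace Aux18

noncomputable def T (r : ℝ) : ℝ := (r ^ 2 - 1) / (1 + r ^ 2)
noncomputable def S (r : ℝ) : ℝ := 4 * r ^ 2 / (1 + r ^ 2) ^ 2

def Sol (β : ℝ) (f p : ℝ → ℝ) : Prop :=
  ∀ r : ℝ, 0 < r → HasDerivAt f (p r / r) r ∧
    HasDerivAt p ((β ^ 2 - 2 * S r) * f r / r) r

lemma TS (r : ℝ) : T r ^ 2 = 1 - S r := by
  have : (1 + r ^ 2) ≠ 0 := by positivity
  unfold T S; field_simp; ring

lemma hT (r : ℝ) (hr : 0 < r) : HasDerivAt T (S r / r) r := by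
  have h0 : (1 + r ^ 2) ≠ 0 := by positivity
  have h := ((hasDerivAt_pow 2 r).sub_const 1).div ((hasDerivAt_pow 2 r).const_add 1) h0
  refine h.congr_deriv ?_
  unfold S; field_simp; push_cast; ring

lemma hS (r : ℝ) (hr : 0 < r) : HasDerivAt S (-2 * T r * S r / r) r := by
  have h1 : HasDerivAt (fun r => 1 - T r ^ 2) (-(2 * T r * (S r / r))) r := by
    have := (((hT r hr).pow 2).const_sub 1)
    refine this.congr_deriv ?_
    push_cast; ring
  have h2 : S = fun r => 1 - T r ^ 2 := by
    funext x; rw [TS]; ring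
  rw [← h2] at h1
  refine h1.congr_deriv ?_
  ring

lemma T0 : Tendsto T (nhdsWithin 0 (Ioi 0)) (nhds (-1)) := by
  have : ContinuousAt T 0 := by
    unfold T
    refine ContinuousAt.div (by fun_prop) (by fun_prop) (by norm_num)
  have h := this.tendsto.mono_left (nhdsWithin_le_nhds (s := Ioi 0))
  simpa [T] using h

lemma Tinf : Tendsto T atTop (nhds 1) := by
  have h : T = fun r => 1 - 2 / (1 + r ^ 2) := by
    funext r
    have : (1 + r ^ 2) ≠ 0 := by positivity
    unfold T; field_simp; ring
  rw [h]
  have h1 : Tendsto (fun r : ℝ => 1 + r ^ 2) atTop atTop :=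
    tendsto_atTop_add_const_left _ _ (tendsto_pow_atTop (by norm_num))
  simpa using (h1.const_div_atTop 2).const_sub 1

lemma Sinf : Tendsto S atTop (nhds 0) := by
  have h2 : S = fun r => 1 - T r ^ 2 := by
    funext x; rw [TS]; ring
  rw [h2]
  simpa using (Tinf.pow 2).const_sub 1

lemma wr {β : ℝ} {f p g q : ℝ → ℝ} (h1 : Sol β f p) (h2 : Sol β g q) :
    ∀ r : ℝ, 0 < r → f r * q r - p r * g r = f 1 * q 1 - p 1 * g 1 := by
  have hd : ∀ r ∈ Ioi (0:ℝ), HasDerivAt (fun r => f r * q r - p r * g r) 0 r := by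
    intro r hr
    obtain ⟨a, b⟩ := h1 r hr
    obtain ⟨c, d⟩ := h2 r hr
    refine ((a.mul d).sub (b.mul c)).congr_deriv ?_
    ring
  intro r hr
  exact isOpen_Ioi.is_const_of_deriv_eq_zero isPreconnected_Ioi
    (fun x hx => (hd x hx).differentiableAt.differentiableWithinAt)
    (fun x hx => (hd x hx).deriv) (x := r) (y := 1) hr (by simp)

lemma key {β : ℝ} {f p g q η P : ℝ → ℝ} (h1 : Sol β f p) (h2 : Sol β g q) (h3 : Sol β η P)
    (hK : f 1 * q 1 - p 1 * g 1 ≠ 0)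
    (hb : ∃ M : ℝ, ∀ r ∈ Ioo (0 : ℝ) 1, |η r| ≤ M)
    (hf : ∃ M : ℝ, ∀ r ∈ Ioo (0 : ℝ) 1, |f r| ≤ M)
    (hg : Tendsto (fun r => |g r|) (nhdsWithin 0 (Ioi 0)) atTop) :
    ∃ a : ℝ, ∀ r : ℝ, 0 < r → η r = a * f r := by
  set K := f 1 * q 1 - p 1 * g 1 with hKd
  set A := η 1 * q 1 - P 1 * g 1 with hA
  set B := η 1 * p 1 - P 1 * f 1 with hB
  have e : ∀ r : ℝ, 0 < r → η r * K = A * f r - B * g r := by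
    intro r hr
    rw [hKd, hA, hB, ← wr h1 h2 r hr, ← wr h3 h2 r hr, ← wr h3 h1 r hr]
    ring
  have hB0 : B = 0 := by
    by_contra hne
    obtain ⟨M, hM⟩ := hb
    obtain ⟨N, hN⟩ := hf
    have hu := hg.eventually (eventually_gt_atTop ((|A| * N + M * |K|) / |B|))
    have hv : ∀ᶠ r in nhdsWithin (0:ℝ) (Ioi 0), r ∈ Ioo (0:ℝ) 1 :=
      Ioo_mem_nhdsGT (by norm_num)
    obtain ⟨r, hr1, hr2⟩ := (hu.and hv).exists
    have hBp : 0 < |B| := abs_pos.mpr hne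
    rw [div_lt_iff₀ hBp, ← abs_mul] at hr1
    have h4 : g r * B = A * f r - η r * K := by rw [e r hr2.1]; ring
    rw [h4] at hr1
    have h5 := abs_sub (A * f r) (η r * K)
    rw [abs_mul, abs_mul] at h5
    have h6 := mul_le_mul_of_nonneg_left (hN r hr2) (abs_nonneg A)
    have h7 := mul_le_mul_of_nonneg_right (hM r hr2) (abs_nonneg K)
    linarith
  refine ⟨A / K, fun r hr => ?_⟩
  have := e r hr
  rw [hB0] at this
  field_simp
  linarith

lemma solF (γ : ℝ) : Sol γ (fun r => r ^ γ * (γ - T r)) (fun r => r ^ γ * (γ * (γ - T r) - S r)) := by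
  intro r hr
  have h := Real.hasDerivAt_rpow_const (x := r) (p := γ) (Or.inl hr.ne')
  rw [Real.rpow_sub_one hr.ne'] at h
  constructor
  · refine (h.mul ((hT r hr).const_sub γ)).congr_deriv ?_
    field_simp
    ring
  · refine (h.mul ((((hT r hr).const_sub γ).const_mul γ).sub (hS r hr))).congr_deriv ?_
    simp only [Pi.sub_apply]
    field_simp
    ring

lemma solF' (γ : ℝ) : Sol γ (fun r => r ^ (-γ) * (-γ - T r))
    (fun r => r ^ (-γ) * (-γ * (-γ - T r) - S r)) := by
  have := solF (-γ)
  unfold Sol at *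
  simpa only [neg_sq] using this

lemma sol0 : Sol 0 (fun r => 1 - Real.log r * T r) (fun r => -T r - Real.log r * S r) := by
  intro r hr
  have h := Real.hasDerivAt_log hr.ne'
  constructor
  · refine ((h.mul (hT r hr)).const_sub 1).congr_deriv ?_
    field_simp; ring
  · refine ((hT r hr).neg.sub (h.mul (hS r hr))).congr_deriv ?_
    field_simp; ring

lemma hphi (r : ℝ) (hr : 0 < r) :
    HasDerivAt (fun r : ℝ => r / (1 + r ^ 2)) (-(r / (1 + r ^ 2)) * T r / r) r := by
  have h0 : (1 + r ^ 2) ≠ 0 := by positivity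
  have h := (hasDerivAt_id' r).div ((hasDerivAt_pow 2 r).const_add 1) h0
  refine h.congr_deriv ?_
  unfold T; field_simp; push_cast; ring

lemma sol1 : Sol 1 (fun r => r / (1 + r ^ 2)) (fun r => -(r / (1 + r ^ 2)) * T r) := by
  intro r hr
  refine ⟨hphi r hr, ?_⟩
  refine ((hphi r hr).neg.mul (hT r hr)).congr_deriv ?_
  have : -(-(r / (1 + r ^ 2)) * T r / r) * T r = (r / (1 + r ^ 2)) * T r ^ 2 / r := by ring
  rw [this, TS]; simp only [Pi.neg_apply]; ring

lemma sol1' : Sol 1 (fun r => r / (1 + r ^ 2) * (4 * Real.log r + r ^ 2 - (r ^ 2)⁻¹))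
    (fun r => -(r / (1 + r ^ 2)) * T r * (4 * Real.log r + r ^ 2 - (r ^ 2)⁻¹) + 2 * (r + r⁻¹)) := by
  intro r hr
  have h0 : (1 + r ^ 2) ≠ 0 := by positivity
  have hr0 := hr.ne'
  have hL : HasDerivAt (fun r : ℝ => 4 * Real.log r + r ^ 2 - (r ^ 2)⁻¹)
      (2 * (r + r⁻¹) ^ 2 / r) r := by
    refine ((((Real.hasDerivAt_log hr0).const_mul 4).add (hasDerivAt_pow 2 r)).sub
      ((hasDerivAt_pow 2 r).inv (by positivity))).congr_deriv ?_
    field_simp; push_cast; ring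
  constructor
  · refine ((sol1 r hr).1.mul hL).congr_deriv ?_
    field_simp; ring
  · refine (((sol1 r hr).2.mul hL).add
      (((hasDerivAt_id' r).add (hasDerivAt_inv hr0)).const_mul 2)).congr_deriv ?_
    have hTT : T r = (r ^ 2 - 1) / (1 + r ^ 2) := rfl
    have : -(r / (1 + r ^ 2)) * T r * (2 * (r + r⁻¹) ^ 2 / r) + 2 * (1 + -(r ^ 2)⁻¹) = 0 := by
      rw [hTT]; field_simp; ring
    linear_combination this

lemma Tbd (r : ℝ) : |T r| ≤ 1 := by
  unfold T
  rw [abs_div, abs_of_pos (show 0 < 1 + r ^ 2 by positivity), div_le_one (by positivity), abs_le]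
  constructor <;> nlinarith [sq_nonneg r]

lemma bdF (γ : ℝ) (h : 0 ≤ γ) : ∃ M : ℝ, ∀ r ∈ Ioo (0 : ℝ) 1, |r ^ γ * (γ - T r)| ≤ M := by
  refine ⟨1 * (γ + 1), fun r hr => ?_⟩
  rw [abs_mul]
  have h1 : |r ^ γ| ≤ 1 := by
    rw [abs_of_pos (Real.rpow_pos_of_pos hr.1 _)]
    exact Real.rpow_le_one hr.1.le hr.2.le h
  have h2 : |γ - T r| ≤ γ + 1 := by
    have := abs_le.mp (Tbd r)
    rw [abs_le]; constructor <;> linarith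
  exact mul_le_mul h1 h2 (abs_nonneg _) (by norm_num)

end Aux18

open Aux18
open Set MeasureTheory Filter

/-- classification of finite-energy solutions of the radial mode equation
`−η'' − η'/r + β²η/r² = 8η/(1+r²)²` on `(0,∞)`: a nontrivial admissible solution exists
only for `β = 0`, with `η = c(1−r²)/(1+r²)`, or `β = 1`, with `η = c r/(1+r²)`. -/
theorem stmt_18 (β : ℝ) (hβ : 0 ≤ β) (η : ℝ → ℝ)
    (hd1 : ∀ r ∈ Ioi (0 : ℝ), DifferentiableAt ℝ η r)
    (hd2 : ∀ r ∈ Ioi (0 : ℝ), DifferentiableAt ℝ (deriv η) r)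
    (hbdd : ∃ M : ℝ, ∀ r ∈ Ioo (0 : ℝ) 1, |η r| ≤ M)
    (hnz : ∃ r : ℝ, 0 < r ∧ η r ≠ 0)
    (hode : ∀ r ∈ Ioi (0 : ℝ),
      -deriv (deriv η) r - (1 / r) * deriv η r + (β ^ 2 / r ^ 2) * η r
        = (8 / (1 + r ^ 2) ^ 2) * η r)
    (hint : IntegrableOn (fun r => r * (deriv η r) ^ 2) (Ioi 0))
    (hlim : 0 < β → Tendsto η (nhdsWithin 0 (Ioi 0)) (nhds 0)) :
    (β = 0 ∧ ∃ c : ℝ, c ≠ 0 ∧ ∀ r : ℝ, 0 < r → η r = c * (1 - r ^ 2) / (1 + r ^ 2)) ∨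
    (β = 1 ∧ ∃ c : ℝ, c ≠ 0 ∧ ∀ r : ℝ, 0 < r → η r = c * r / (1 + r ^ 2)) := by

  have hsol : Sol β η (fun r => r * deriv η r) := by
    intro r hr
    have hr0 := hr.ne'
    constructor
    · refine (hd1 r hr).hasDerivAt.congr_deriv ?_
      field_simp
    · refine ((hasDerivAt_id' r).mul (hd2 r hr).hasDerivAt).congr_deriv ?_
      have h := hode r hr
      have h0 : (1 + r ^ 2) ≠ 0 := by positivity
      have hS : 8 / (1 + r ^ 2) ^ 2 = 2 * S r / r ^ 2 := by
        unfold S; field_simp; norm_num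
      rw [hS] at h
      field_simp at h ⊢
      linear_combination -h
  obtain ⟨r₀, hr₀, hη₀⟩ := hnz
  rcases hβ.eq_or_lt with h0 | hpos
  · left
    subst h0
    refine ⟨rfl, ?_⟩
    obtain ⟨a, ha⟩ := key (solF 0) sol0 hsol (by norm_num [T, S]) hbdd (bdF 0 le_rfl) (by
      have h1 := Real.tendsto_log_nhdsGT_zero.atBot_mul_neg (by norm_num : (-1:ℝ) < 0) T0
      exact tendsto_abs_atBot_atTop.comp (tendsto_atBot_add_const_left _ 1
        (tendsto_neg_atTop_atBot.comp h1)))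
    refine ⟨a, ?_, ?_⟩
    · rintro rfl
      exact hη₀ (by simpa using ha r₀ hr₀)
    · intro r hr
      rw [ha r hr]
      simp only [Real.rpow_zero, T]
      ring
  by_cases h1 : β = 1
  · right
    subst h1
    refine ⟨rfl, ?_⟩
    obtain ⟨a, ha⟩ := key sol1 sol1' hsol (by norm_num [T, S]) hbdd
      ⟨1, fun r hr => by
        have := hr.1
        rw [abs_of_pos (by positivity), div_le_one (by positivity)]
        nlinarith [hr.2, hr.1]⟩ (by
      have hinv : Tendsto (fun r : ℝ => r⁻¹ + (-1)) (nhdsWithin 0 (Ioi 0)) atTop :=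
        tendsto_atTop_add_const_right _ _ tendsto_inv_nhdsGT_zero
      refine tendsto_atTop_mono' _ ?_ hinv
      have hv : ∀ᶠ r in nhdsWithin (0:ℝ) (Ioi 0), r ∈ Ioo (0:ℝ) 1 :=
        Ioo_mem_nhdsGT (by norm_num)
      filter_upwards [hv] with r hr
      have hrp := hr.1
      refine le_trans ?_ (neg_le_abs _)
      have hlog := Real.log_nonpos hr.1.le hr.2.le
      have e : r / (1 + r ^ 2) * (r ^ 2 - (r ^ 2)⁻¹) = r - r⁻¹ := by
        field_simp; ring
      have e2 : r / (1 + r ^ 2) * (4 * Real.log r) ≤ 0 :=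
        mul_nonpos_of_nonneg_of_nonpos (by positivity) (by linarith)
      have := hr.2
      linarith [e, e2])
    refine ⟨a, ?_, ?_⟩
    · rintro rfl
      exact hη₀ (by simpa using ha r₀ hr₀)
    · intro r hr
      rw [ha r hr]
      ring
  exfalso
  have hβ1 : 1 - β ≠ 0 := fun h => h1 (by linarith)
  obtain ⟨a, ha⟩ := key (solF β) (solF' β) hsol (by
      have hS1 : S 1 = 1 := by norm_num [S]
      have hT1 : T 1 = 0 := by norm_num [T]
      simp only [Real.one_rpow, hS1, hT1]
      have : 2 * β * (β - 1) * (β + 1) ≠ 0 := by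
        have : β - 1 ≠ 0 := fun h => h1 (by linarith)
        have : β + 1 ≠ 0 := by positivity
        positivity
      intro h
      apply this
      linear_combination h) hbdd (bdF β hβ) (by
      have h2 : Tendsto (fun r => |-β - T r|) (nhdsWithin 0 (Ioi 0)) (nhds |1 - β|) := by
        have := (T0.const_sub (-β)).abs
        rwa [show -β - -1 = 1 - β by ring] at this
      have h3 : Tendsto (fun r : ℝ => r ^ (-β)) (nhdsWithin 0 (Ioi 0)) atTop :=
        tendsto_rpow_neg_nhdsGT_zero (by linarith)
      have h4 := (tendsto_abs_atTop_atTop.comp h3).atTop_mul_pos (abs_pos.mpr hβ1) h2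
      simpa only [abs_mul, Function.comp_apply] using h4)
  have ha0 : a ≠ 0 := by
    rintro rfl
    exact hη₀ (by simpa using ha r₀ hr₀)
  -- the derivative
  have hder : ∀ r : ℝ, 0 < r → r * deriv η r = a * (r ^ β * (β * (β - T r) - S r)) := by
    intro r hr
    have h5 := ((solF β r hr).1.const_mul a)
    have h6 : η =ᶠ[nhds r] fun r => a * (r ^ β * (β - T r)) := by
      filter_upwards [Ioi_mem_nhds hr] with x hx using ha x hx
    rw [h6.deriv_eq, h5.deriv]
    field_simp
  have hlimit : Tendsto (fun r => |a * (r ^ β * (β * (β - T r) - S r))|) atTop atTop := by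
    have h2 : Tendsto (fun r => |β * (β - T r) - S r|) atTop (nhds |β * (β - 1) - 0|) :=
      (((Tinf.const_sub β).const_mul β).sub Sinf).abs
    have h7 : 0 < |β * (β - 1) - 0| := by
      rw [abs_pos, sub_zero]
      exact mul_ne_zero hpos.ne' (fun h => h1 (by linarith))
    have h4 := (tendsto_abs_atTop_atTop.comp (tendsto_rpow_atTop hpos)).atTop_mul_pos h7 h2
    have h8 := h4.const_mul_atTop (abs_pos.mpr ha0)
    simpa only [abs_mul, Function.comp_apply] using h8
  obtain ⟨R, hR⟩ := (hlimit.eventually (eventually_ge_atTop 1)).exists_forall_of_atTop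
  have hR' : IntegrableOn (fun r : ℝ => r * (deriv η r) ^ 2) (Ioi (max R 1)) :=
    hint.mono_set (Ioi_subset_Ioi (by positivity))
  refine not_integrableOn_Ioi_inv (a := max R 1) ?_
  refine Integrable.mono' hR' (by fun_prop) ?_
  filter_upwards [ae_restrict_mem measurableSet_Ioi] with r hr
  have hr1 : max R 1 < r := hr
  have hrp : 0 < r := lt_of_lt_of_le one_pos ((le_max_right R 1).trans hr1.le)
  have h9 := hR r ((le_max_left R 1).trans hr1.le)
  rw [← hder r hrp] at h9
  have h10 : 1 ≤ (r * deriv η r) ^ 2 := by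
    rw [← sq_abs]; nlinarith
  rw [Real.norm_of_nonneg (by positivity)]
  calc r⁻¹ = r⁻¹ * 1 := by ring
    _ ≤ r⁻¹ * (r * deriv η r) ^ 2 := by gcongr
    _ = r * (deriv η r) ^ 2 := by field_simp
end
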